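/- arXiv:2007.01624 — 9 statements merged into one kernel-verified Lean document; each statement's English description precedes it below -/
import Mathlib

section
/- Let I ⊂ ℝ be a bounded interval of length d > 0 and let f : I → ℂ be absolutely continuous on I with a.e. derivative f′ ∈ L²(I). Then for every y ∈ I the following two-sided estimate holds: (1/(2d))·∫_I |f(x)|² dx − (d/2)·∫_I |f′(x)|² dx ≤ |f(y)|² ≤ (2/d)·∫_I |f(x)|² dx + d·∫_I |f′(x)|² dx. -/
open MeasureTheory Set

/-- Cauchy–Schwarz for the integral of a norm over a bounded interval. -/
theorem sq_norm_intervalIntegral_le {u v : ℝ} (huv : u ≤ v) {g : ℝ → ℂ}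
    (hg : IntegrableOn g (Ioc u v)) (hg2 : IntegrableOn (fun x => ‖g x‖ ^ 2) (Ioc u v)) :
    ‖∫ x in u..v, g x‖ ^ 2 ≤ (v - u) * ∫ x in Ioc u v, ‖g x‖ ^ 2 := by
  rcases huv.eq_or_lt with rfl | huv
  · simp
  have hL : 0 < v - u := sub_pos.2 huv
  have hM : ‖∫ x in u..v, g x‖ ≤ ∫ x in Ioc u v, ‖g x‖ := by
    rw [intervalIntegral.integral_of_le huv.le]
    exact norm_integral_le_integral_norm _
  set M := ∫ x in Ioc u v, ‖g x‖ with hMdef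
  set m := M / (v - u) with hm
  have hnonneg : 0 ≤ ∫ x in Ioc u v, (‖g x‖ - m) ^ 2 :=
    integral_nonneg fun x => sq_nonneg _
  have hexpand : ∫ x in Ioc u v, (‖g x‖ - m) ^ 2 =
      (∫ x in Ioc u v, ‖g x‖ ^ 2) - 2 * m * M + (v - u) * m ^ 2 := by
    have hlin : IntegrableOn (fun x => 2 * m * ‖g x‖) (Ioc u v) := hg.norm.const_mul _
    have hconst : IntegrableOn (fun _ : ℝ => m ^ 2) (Ioc u v) := by simp
    have hdiff : IntegrableOn (fun x => ‖g x‖ ^ 2 - 2 * m * ‖g x‖) (Ioc u v) := hg2.sub hlin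
    calc ∫ x in Ioc u v, (‖g x‖ - m) ^ 2
        = ∫ x in Ioc u v, (‖g x‖ ^ 2 - 2 * m * ‖g x‖ + m ^ 2) := by
          congr 1 with x
          ring
      _ = _ := by
          rw [integral_add hdiff hconst, integral_sub hg2 hlin, integral_const_mul, ← hMdef]
          simp [huv.le]
  have hMm : M = (v - u) * m := by
    rw [hm]
    field_simp
  have hsq : ‖∫ x in u..v, g x‖ ^ 2 ≤ M ^ 2 := by gcongr
  have hbound : (v - u) * m ^ 2 ≤ ∫ x in Ioc u v, ‖g x‖ ^ 2 := by
    rw [hexpand, hMm] at hnonneg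
    nlinarith
  calc ‖∫ x in u..v, g x‖ ^ 2 ≤ M ^ 2 := hsq
    _ = (v - u) * ((v - u) * m ^ 2) := by rw [hMm]; ring
    _ ≤ _ := by gcongr

theorem integral_abs_sub_le {a b y : ℝ} (hy : y ∈ Icc a b) :
    ∫ x in a..b, |x - y| ≤ (b - a) ^ 2 / 2 := by
  have hcont : Continuous fun x : ℝ => |x - y| := by fun_prop
  have hleft : ∫ x in a..y, |x - y| = ∫ x in a..y, (y - x) := by
    refine intervalIntegral.integral_congr fun x hx => ?_
    rw [uIcc_of_le hy.1] at hx
    simp [abs_of_nonpos (sub_nonpos.2 hx.2)]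
  have hright : ∫ x in y..b, |x - y| = ∫ x in y..b, (x - y) := by
    refine intervalIntegral.integral_congr fun x hx => ?_
    rw [uIcc_of_le hy.2] at hx
    simp [abs_of_nonneg (sub_nonneg.2 hx.1)]
  rw [← intervalIntegral.integral_add_adjacent_intervals (hcont.intervalIntegrable a y)
    (hcont.intervalIntegrable y b), hleft, hright,
    intervalIntegral.integral_sub (by simp) (by simp),
    intervalIntegral.integral_sub (by simp) (by simp)]
  simp only [intervalIntegral.integral_const, integral_id, smul_eq_mul]
  nlinarith [mul_nonneg (sub_nonneg.2 hy.1) (sub_nonneg.2 hy.2)]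

theorem sq_norm_le_two_mul_add (z w : ℂ) : ‖z‖ ^ 2 ≤ 2 * ‖w‖ ^ 2 + 2 * ‖z - w‖ ^ 2 := by
  have h : ‖z‖ ≤ ‖w‖ + ‖z - w‖ := by simpa using norm_add_le w (z - w)
  nlinarith [norm_nonneg z, sq_nonneg (‖w‖ - ‖z - w‖)]

/-- **Brinck's lemma.** Let `I = [a, b]` be a bounded interval of length `d > 0` and let
`f : I → ℂ` be absolutely continuous on `I` (i.e. an indefinite integral of its a.e.
derivative `g`) with `g ∈ L²(I)`.  Then for every `y ∈ I`,
`(1/(2d))·∫_I |f|² − (d/2)·∫_I |f′|² ≤ |f(y)|² ≤ (2/d)·∫_I |f|² + d·∫_I |f′|²`. -/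
theorem brinck_lemma (a b d : ℝ) (hd : d = b - a) (hd0 : 0 < d)
    (f g : ℝ → ℂ)
    (hg_int : IntegrableOn g (Icc a b))
    (hg2 : IntegrableOn (fun x => ‖g x‖ ^ 2) (Icc a b))
    (hfg : ∀ y ∈ Icc a b, f y - f a = ∫ x in a..y, g x)
    (y : ℝ) (hy : y ∈ Icc a b) :
    (1 / (2 * d)) * (∫ x in Icc a b, ‖f x‖ ^ 2) - (d / 2) * (∫ x in Icc a b, ‖g x‖ ^ 2)
        ≤ ‖f y‖ ^ 2 ∧
      ‖f y‖ ^ 2 ≤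
        (2 / d) * (∫ x in Icc a b, ‖f x‖ ^ 2) + d * (∫ x in Icc a b, ‖g x‖ ^ 2) := by
  have hab : a ≤ b := by linarith
  set F := ∫ x in Icc a b, ‖f x‖ ^ 2 with hF
  set G := ∫ x in Icc a b, ‖g x‖ ^ 2
  have hG0 : 0 ≤ G := integral_nonneg fun x => sq_nonneg _
  have hii : ∀ u ∈ Icc a b, IntervalIntegrable g volume a u := fun u hu =>
    (intervalIntegrable_iff_integrableOn_Ioc_of_le hu.1).2
      (hg_int.mono_set (Ioc_subset_Icc_self.trans (Icc_subset_Icc_right hu.2)))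
  have hdiff : ∀ u ∈ Icc a b, ∀ v ∈ Icc a b, f v - f u = ∫ x in u..v, g x := by
    intro u hu v hv
    rw [← intervalIntegral.integral_interval_sub_left (hii v hv) (hii u hu),
      ← hfg v hv, ← hfg u hu]
    ring
  have hle : ∀ u ∈ Icc a b, ∀ v ∈ Icc a b, u ≤ v → ‖f v - f u‖ ^ 2 ≤ (v - u) * G := by
    intro u hu v hv huv
    have hsub : Ioc u v ⊆ Icc a b := Ioc_subset_Icc_self.trans (Icc_subset_Icc hu.1 hv.2)
    rw [hdiff u hu v hv]
    refine (sq_norm_intervalIntegral_le huv (hg_int.mono_set hsub) (hg2.mono_set hsub)).trans ?_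
    exact mul_le_mul_of_nonneg_left
      (setIntegral_mono_set hg2 (ae_of_all _ fun x => sq_nonneg _) hsub.eventuallyLE)
      (sub_nonneg.2 huv)
  have hholder : ∀ x ∈ Icc a b, ‖f x - f y‖ ^ 2 ≤ |x - y| * G := by
    intro x hx
    rcases le_total y x with h | h
    · rw [abs_of_nonneg (sub_nonneg.2 h)]
      exact hle y hy x hx h
    · rw [abs_sub_comm, abs_of_nonneg (sub_nonneg.2 h), norm_sub_rev]
      exact hle x hx y hy h
  have hfc : ContinuousOn f (Icc a b) := by
    have hprim : ContinuousOn (fun u => f a + ∫ x in a..u, g x) (Icc a b) := by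
      have := intervalIntegral.continuousOn_primitive_interval (μ := volume) (f := g)
        (a := a) (b := b) (by rwa [uIcc_of_le hab])
      rw [uIcc_of_le hab] at this
      exact continuousOn_const.add this
    refine hprim.congr fun u hu => ?_
    change f u = f a + ∫ x in a..u, g x
    rw [← hfg u hu]
    ring
  have hf2 : IntervalIntegrable (fun x => ‖f x‖ ^ 2) volume a b :=
    ContinuousOn.intervalIntegrable_of_Icc hab (hfc.norm.pow 2)
  have hFi : F = ∫ x in a..b, ‖f x‖ ^ 2 := by
    rw [intervalIntegral.integral_of_le hab, hF, integral_Icc_eq_integral_Ioc]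
  have habs : IntervalIntegrable (fun x => 2 * (|x - y| * G)) volume a b :=
    Continuous.intervalIntegrable (by fun_prop) a b
  have hcst : ∀ c : ℝ, IntervalIntegrable (fun _ => c) volume a b := fun c => by simp
  have hA : ∫ x in a..b, 2 * (|x - y| * G) ≤ d ^ 2 * G := by
    rw [intervalIntegral.integral_const_mul, intervalIntegral.integral_mul_const, hd]
    nlinarith [mul_le_mul_of_nonneg_right (integral_abs_sub_le hy) hG0]
  have hlower : F ≤ 2 * d * ‖f y‖ ^ 2 + d ^ 2 * G := by
    have h := intervalIntegral.integral_mono_on hab hf2 ((hcst (2 * ‖f y‖ ^ 2)).add habs)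
      fun x hx => by
        have := sq_norm_le_two_mul_add (f x) (f y)
        have := hholder x hx
        linarith
    rw [intervalIntegral.integral_add (hcst _) habs, intervalIntegral.integral_const,
      smul_eq_mul, ← hd, ← hFi] at h
    linarith
  have hupper : d * ‖f y‖ ^ 2 ≤ 2 * F + d ^ 2 * G := by
    have h := intervalIntegral.integral_mono_on hab (hcst (‖f y‖ ^ 2))
      ((hf2.const_mul 2).add habs) fun x hx => by
        have := sq_norm_le_two_mul_add (f y) (f x)
        have := hholder x hx
        rw [norm_sub_rev] at this
        linarith
    rw [intervalIntegral.integral_add (hf2.const_mul 2) habs, intervalIntegral.integral_const,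
      intervalIntegral.integral_const_mul, smul_eq_mul, ← hd, ← hFi] at h
    linarith
  constructor
  · have : 1 / (2 * d) * F - d / 2 * G = (F - d ^ 2 * G) / (2 * d) := by field_simp
    rw [this, div_le_iff₀ (by positivity)]
    linarith
  · have : 2 / d * F + d * G = (2 * F + d ^ 2 * G) / d := by field_simp
    rw [this, le_div_iff₀ hd0]
    linarith
end

section
/- Let β ≥ 0 and μ = μ₊ − μ₋ ∈ 𝔐_β. Then for every f ∈ D(a_μ) the form is lower semibounded with bound −2·max{β, β²}: a_μ(f, f) ≥ −2·max{β, β²}·‖f‖². -/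
open MeasureTheory Set Filter ENNReal

/-- `∫ |f|² dν`, as a value in `[0, ∞]`. -/
noncomputable def sqInt (ν : Measure ℝ) (f : ℝ → ℂ) : ℝ≥0∞ :=
  ∫⁻ x, (‖f x‖₊ : ℝ≥0∞) ^ 2 ∂ν

/-- `f` belongs to the form domain `D(a_μ)` with a.e. derivative `g`:
`f` is locally absolutely continuous (an indefinite integral of the locally integrable
function `g`), `f ∈ L²(ℝ)`, `g = f′ ∈ L²(ℝ)` and `∫ |f|² dμ₊ < ∞`. -/
structure MemDom (μp : Measure ℝ) (f g : ℝ → ℂ) : Prop where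
  locInt : LocallyIntegrable g volume
  fund : ∀ a b : ℝ, f b - f a = ∫ x in a..b, g x
  f_L2 : sqInt volume f < ⊤
  g_L2 : sqInt volume g < ⊤
  f_mu : sqInt μp f < ⊤

/-- The quadratic form `a_μ(f, f) = ∫ |f′|² dx + ∫ |f|² dμ₊ − ∫ |f|² dμ₋`,
where `g` is the a.e. derivative of `f`. -/
noncomputable def formQ (μp μm : Measure ℝ) (f g : ℝ → ℂ) : ℝ :=
  (sqInt volume g).toReal + (sqInt μp f).toReal - (sqInt μm f).toReal

/-- The real part, imaginary part or any other real-linear functional of an indefinite integral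
is absolutely continuous. -/
lemma absolutelyContinuousOnInterval_clm_comp {f g : ℝ → ℂ} (hg : LocallyIntegrable g volume)
    (hfg : ∀ a b : ℝ, f b - f a = ∫ x in a..b, g x) (L : ℂ →L[ℝ] ℝ) (a b : ℝ) :
    AbsolutelyContinuousOnInterval (fun x ↦ L (f x)) a b := by
  have hgi : ∀ c d : ℝ, IntervalIntegrable g volume c d := fun c d ↦
    (hg.integrableOn_isCompact isCompact_uIcc).intervalIntegrable
  have hLg : IntervalIntegrable (fun x ↦ L (g x)) volume a b :=
    ⟨L.integrable_comp (hgi a b).1, L.integrable_comp (hgi a b).2⟩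
  have hLf : (fun x ↦ L (f x)) = fun x ↦ (∫ t in a..x, L (g t)) + L (f a) := by
    funext x
    rw [L.intervalIntegral_comp_comm (hgi a x), ← hfg a x, map_sub, sub_add_cancel]
  rw [hLf]
  exact (hLg.absolutelyContinuousOnInterval_intervalIntegral left_mem_uIcc).fun_add
    ((LipschitzWith.const (L (f a))).lipschitzOnWith (s := uIcc a b)).absolutelyContinuousOnInterval

lemma continuous_of_sub_eq_integral {f g : ℝ → ℂ} (hg : LocallyIntegrable g volume)
    (hfg : ∀ a b : ℝ, f b - f a = ∫ x in a..b, g x) : Continuous f := by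
  have hf : f = fun x ↦ (∫ t in (0 : ℝ)..x, g t) + f 0 := by
    funext x
    rw [← hfg 0 x, sub_add_cancel]
  rw [hf]
  exact (intervalIntegral.continuous_primitive (fun c d ↦
    (hg.integrableOn_isCompact isCompact_uIcc).intervalIntegrable) 0).add continuous_const

lemma ae_hasDerivAt_of_sub_eq_integral {f g : ℝ → ℂ} (hg : LocallyIntegrable g volume)
    (hfg : ∀ a b : ℝ, f b - f a = ∫ x in a..b, g x) : ∀ᵐ x, HasDerivAt f (g x) x := by
  filter_upwards [LocallyIntegrable.ae_hasDerivAt_integral hg] with x hx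
  have hf : f = fun x ↦ (∫ t in (0 : ℝ)..x, g t) + f 0 := by
    funext x
    rw [← hfg 0 x, sub_add_cancel]
  rw [hf]
  exact (hx 0).add_const _

/-- If `f` is an indefinite integral of `g`, then `|f(b)|² ≤ |f(a)|² + 2 ∫ |f| |g|`, where the
integral is over the interval between `a` and `b`. -/
lemma sq_norm_le_sq_norm_add_integral {f g : ℝ → ℂ} (hg : LocallyIntegrable g volume)
    (hfg : ∀ a b : ℝ, f b - f a = ∫ x in a..b, g x) (a b : ℝ) :
    ‖f b‖ₑ ^ 2 ≤ ‖f a‖ₑ ^ 2 + ∫⁻ x in uIoc a b, 2 * ‖f x‖ₑ * ‖g x‖ₑ := by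
  have hre := absolutelyContinuousOnInterval_clm_comp hg hfg Complex.reCLM a b
  have him := absolutelyContinuousOnInterval_clm_comp hg hfg Complex.imCLM a b
  have hu := (hre.fun_mul hre).fun_add (him.fun_mul him)
  have hftc := hu.integral_deriv_eq_sub
  have hsq : ∀ x, Complex.reCLM (f x) * Complex.reCLM (f x) +
      Complex.imCLM (f x) * Complex.imCLM (f x) = ‖f x‖ ^ 2 := fun x ↦ by
    rw [← Complex.normSq_eq_norm_sq, Complex.normSq_apply]; rfl
  simp only [hsq] at hftc
  have hbound : ‖∫ x in a..b, deriv (fun x ↦ ‖f x‖ ^ 2) x‖ₑ ≤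
      ∫⁻ x in uIoc a b, 2 * ‖f x‖ₑ * ‖g x‖ₑ := by
    rw [← enorm_norm, intervalIntegral.norm_integral_eq_norm_integral_uIoc, enorm_norm]
    refine (enorm_integral_le_lintegral_enorm _).trans (lintegral_mono_ae ?_)
    filter_upwards [ae_restrict_of_ae (ae_hasDerivAt_of_sub_eq_integral hg hfg)] with x hx
    have hd := hx.norm_sq
    rw [hd.deriv, enorm_mul, mul_assoc]
    refine mul_le_mul' (by simp [enorm_eq_nnnorm]) ?_
    rw [enorm_eq_nnnorm, enorm_eq_nnnorm, enorm_eq_nnnorm]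
    exact_mod_cast nnnorm_inner_le_nnnorm (𝕜 := ℝ) (f x) (g x)
  rw [hftc] at hbound
  calc ‖f b‖ₑ ^ 2 = ‖‖f a‖ ^ 2 + (‖f b‖ ^ 2 - ‖f a‖ ^ 2)‖ₑ := by
        rw [add_sub_cancel, enorm_pow, enorm_norm]
    _ ≤ ‖‖f a‖ ^ 2‖ₑ + ‖‖f b‖ ^ 2 - ‖f a‖ ^ 2‖ₑ := enorm_add_le _ _
    _ ≤ _ := by
        rw [enorm_pow, enorm_norm]
        gcongr

/-- On an interval of length one, a function is controlled pointwise by integrals of itself and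
of its derivative. -/
lemma sq_norm_le_lintegral_Ioc {f g : ℝ → ℂ} (hg : LocallyIntegrable g volume)
    (hfg : ∀ a b : ℝ, f b - f a = ∫ x in a..b, g x) {c y : ℝ} (hy : y ∈ Ioc c (c + 1)) :
    ‖f y‖ₑ ^ 2 ≤ (∫⁻ x in Ioc c (c + 1), ‖f x‖ₑ ^ 2) +
      ∫⁻ x in Ioc c (c + 1), 2 * ‖f x‖ₑ * ‖g x‖ₑ := by
  have hvol : volume (Ioc c (c + 1)) = 1 := by simp
  set B := ∫⁻ x in Ioc c (c + 1), 2 * ‖f x‖ₑ * ‖g x‖ₑ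
  calc ‖f y‖ₑ ^ 2 = ∫⁻ _ in Ioc c (c + 1), ‖f y‖ₑ ^ 2 := by simp
    _ ≤ ∫⁻ x in Ioc c (c + 1), (‖f x‖ₑ ^ 2 + B) := by
        refine setLIntegral_mono' measurableSet_Ioc fun x hx ↦ ?_
        refine (sq_norm_le_sq_norm_add_integral hg hfg x y).trans ?_
        gcongr
        refine lintegral_mono_set fun t ht ↦ ?_
        rw [mem_uIoc] at ht
        rcases ht with ht | ht
        · exact ⟨hx.1.trans ht.1, ht.2.trans hy.2⟩
        · exact ⟨hy.1.trans ht.1, ht.2.trans hx.2⟩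
    _ = _ := by
        rw [lintegral_add_right _ measurable_const, setLIntegral_const, hvol, mul_one]

lemma mul_two_mul_enorm_le (b : ℝ≥0∞) (hb : b ≠ ⊤) (z w : ℂ) :
    b * (2 * ‖z‖ₑ * ‖w‖ₑ) ≤ b ^ 2 * ‖z‖ₑ ^ 2 + ‖w‖ₑ ^ 2 := by
  lift b to NNReal using hb
  rw [enorm_eq_nnnorm, enorm_eq_nnnorm]
  norm_cast
  rw [← NNReal.coe_le_coe]
  push_cast
  nlinarith [sq_nonneg ((b : ℝ) * ‖z‖ - ‖w‖)]

lemma lintegral_Ioc_sq_norm_le {f g : ℝ → ℂ} (hg : LocallyIntegrable g volume)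
    (hfg : ∀ a b : ℝ, f b - f a = ∫ x in a..b, g x) {ν : Measure ℝ} {b : ℝ≥0∞} (hb : b ≠ ⊤)
    {c : ℝ} (hν : ν (Ioc c (c + 1)) ≤ b) :
    ∫⁻ x in Ioc c (c + 1), ‖f x‖ₑ ^ 2 ∂ν ≤
      ∫⁻ x in Ioc c (c + 1), ((b + b ^ 2) * ‖f x‖ₑ ^ 2 + ‖g x‖ₑ ^ 2) := by
  have hm : Measurable fun x ↦ ‖f x‖ₑ ^ 2 :=
    (continuous_of_sub_eq_integral hg hfg).measurable.enorm.pow_const 2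
  calc ∫⁻ x in Ioc c (c + 1), ‖f x‖ₑ ^ 2 ∂ν
      ≤ ∫⁻ _ in Ioc c (c + 1), ((∫⁻ x in Ioc c (c + 1), ‖f x‖ₑ ^ 2) +
          ∫⁻ x in Ioc c (c + 1), 2 * ‖f x‖ₑ * ‖g x‖ₑ) ∂ν :=
        setLIntegral_mono' measurableSet_Ioc fun x hx ↦ sq_norm_le_lintegral_Ioc hg hfg hx
    _ ≤ b * ((∫⁻ x in Ioc c (c + 1), ‖f x‖ₑ ^ 2) +
          ∫⁻ x in Ioc c (c + 1), 2 * ‖f x‖ₑ * ‖g x‖ₑ) := by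
        rw [setLIntegral_const, mul_comm]
        gcongr
    _ = ∫⁻ x in Ioc c (c + 1), (b * ‖f x‖ₑ ^ 2 + b * (2 * ‖f x‖ₑ * ‖g x‖ₑ)) := by
        rw [lintegral_add_left (hm.const_mul b), lintegral_const_mul' _ _ hb,
          lintegral_const_mul' _ _ hb, mul_add]
    _ ≤ _ := by
        refine lintegral_mono fun x ↦ ?_
        rw [add_mul, add_assoc]
        gcongr
        exact mul_two_mul_enorm_le b hb _ _

lemma lintegral_eq_tsum_Ioc_intCast (ν : Measure ℝ) (F : ℝ → ℝ≥0∞) :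
    ∫⁻ x, F x ∂ν = ∑' n : ℤ, ∫⁻ x in Ioc (n : ℝ) (n + 1), F x ∂ν := by
  rw [← lintegral_iUnion (fun _ ↦ measurableSet_Ioc) (pairwise_disjoint_Ioc_intCast ℝ),
    iUnion_Ioc_intCast, Measure.restrict_univ]

lemma sqInt_le_of_measure_Icc_le {f g : ℝ → ℂ} (hg : LocallyIntegrable g volume)
    (hfg : ∀ a b : ℝ, f b - f a = ∫ x in a..b, g x) {ν : Measure ℝ} {b : ℝ≥0∞} (hb : b ≠ ⊤)
    (hν : ∀ x : ℝ, ν (Icc x (x + 1)) ≤ b) :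
    sqInt ν f ≤ (b + b ^ 2) * sqInt volume f + sqInt volume g := by
  have hm : Measurable fun x ↦ ‖f x‖ₑ ^ 2 :=
    (continuous_of_sub_eq_integral hg hfg).measurable.enorm.pow_const 2
  change ∫⁻ x, ‖f x‖ₑ ^ 2 ∂ν ≤ (b + b ^ 2) * (∫⁻ x, ‖f x‖ₑ ^ 2) + ∫⁻ x, ‖g x‖ₑ ^ 2
  rw [← lintegral_const_mul _ hm, ← lintegral_add_left (hm.const_mul _),
    lintegral_eq_tsum_Ioc_intCast ν, lintegral_eq_tsum_Ioc_intCast volume]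
  exact ENNReal.tsum_le_tsum fun n ↦ lintegral_Ioc_sq_norm_le hg hfg hb
    ((measure_mono Ioc_subset_Icc_self).trans (hν n))

/-- Lower semiboundedness of the form `a_μ` for `μ = μ₊ − μ₋ ∈ 𝔐_β`:
`a_μ(f, f) ≥ −2·max{β, β²}·‖f‖²` for every `f ∈ D(a_μ)`. -/
theorem form_lower_semibounded (β : ℝ) (hβ : 0 ≤ β)
    (μp μm : Measure ℝ) [μp.Regular] [μm.Regular]
    (hμp : μp univ ≠ 0)
    (hμm : ∀ x : ℝ, μm (Icc x (x + 1)) ≤ ENNReal.ofReal β)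
    (f g : ℝ → ℂ) (hf : MemDom μp f g) :
    -2 * max β (β ^ 2) * (sqInt volume f).toReal ≤ formQ μp μm f g := by
  have hb : ENNReal.ofReal β ≠ ⊤ := ENNReal.ofReal_ne_top
  have hle := sqInt_le_of_measure_Icc_le hf.locInt hf.fund hb hμm
  have hA : (ENNReal.ofReal β + ENNReal.ofReal β ^ 2) * sqInt volume f ≠ ⊤ :=
    ENNReal.mul_ne_top (ENNReal.add_ne_top.2 ⟨hb, ENNReal.pow_ne_top hb⟩) hf.f_L2.ne
  have hreal := ENNReal.toReal_mono (ENNReal.add_ne_top.2 ⟨hA, hf.g_L2.ne⟩) hle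
  rw [ENNReal.toReal_add hA hf.g_L2.ne, ENNReal.toReal_mul,
    ENNReal.toReal_add hb (ENNReal.pow_ne_top hb), ENNReal.toReal_pow,
    ENNReal.toReal_ofReal hβ] at hreal
  have hmax : (β + β ^ 2) * (sqInt volume f).toReal ≤
      2 * max β (β ^ 2) * (sqInt volume f).toReal := by
    gcongr
    linarith [le_max_left β (β ^ 2), le_max_right β (β ^ 2)]
  have hp : 0 ≤ (sqInt μp f).toReal := ENNReal.toReal_nonneg
  unfold formQ
  linarith
end

section
/- Let μ_n (n ∈ ℕ) and μ be positive Radon measures on ℝ such that ∫_ℝ f dμ_n → ∫_ℝ f dμ for every continuous compactly supported function f : ℝ → ℝ. Then the Otelbaev functions converge pointwise: q*_{μ_n}(x) → q*_μ(x) for every x ∈ ℝ. -/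
open MeasureTheory Set Filter ENNReal

/-- `d_μ(x) = sup {d ≥ 0 : d·μ([x − d/2, x + d/2]) ≤ 1}` (a real number; by Lean's
convention `sSup` of a set unbounded above is `0`, which corresponds to `d_μ(x) = ∞`). -/
noncomputable def dFun (μ : Measure ℝ) (x : ℝ) : ℝ :=
  sSup {d : ℝ | 0 ≤ d ∧ ENNReal.ofReal d * μ (Icc (x - d / 2) (x + d / 2)) ≤ 1}

/-- Otelbaev's function `q*_μ(x) = 1/d_μ(x)²` (equal to `0` when `d_μ(x) = ∞`,
by the convention `1/0 = 0`). -/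
noncomputable def qstar (μ : Measure ℝ) (x : ℝ) : ℝ := 1 / (dFun μ x) ^ 2

namespace Otelbaev

variable (μ : Measure ℝ) (x : ℝ)

theorem ofReal_mul_measure_Icc_le_one_iff [IsFiniteMeasureOnCompacts μ] {d : ℝ} (hd : 0 ≤ d) :
    ENNReal.ofReal d * μ (Icc (x - d / 2) (x + d / 2)) ≤ 1 ↔
      d * μ.real (Icc (x - d / 2) (x + d / 2)) ≤ 1 := by
  rw [← ofReal_measureReal (measure_Icc_lt_top (μ := μ)).ne, ← ENNReal.ofReal_mul hd,
    ENNReal.ofReal_le_one]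

theorem mul_measureReal_Icc_mono [IsFiniteMeasureOnCompacts μ] {d e : ℝ} (hd : 0 ≤ d)
    (hde : d ≤ e) :
    d * μ.real (Icc (x - d / 2) (x + d / 2)) ≤ e * μ.real (Icc (x - e / 2) (x + e / 2)) := by
  have he : 0 ≤ e := hd.trans hde
  have := measureReal_mono (μ := μ) (Icc_subset_Icc (by linarith : x - e / 2 ≤ x - d / 2)
    (by linarith : x + d / 2 ≤ x + e / 2)) (measure_Icc_lt_top).ne
  gcongr

theorem dFun_eq [IsFiniteMeasureOnCompacts μ] :
    dFun μ x = sSup {d : ℝ | 0 ≤ d ∧ d * μ.real (Icc (x - d / 2) (x + d / 2)) ≤ 1} := by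
  unfold dFun
  congr 1
  ext d
  exact and_congr_right fun hd => ofReal_mul_measure_Icc_le_one_iff μ x hd

theorem exists_pos_mul_measureReal_Icc_le_one [IsFiniteMeasureOnCompacts μ] :
    ∃ d : ℝ, 0 < d ∧ d * μ.real (Icc (x - d / 2) (x + d / 2)) ≤ 1 := by
  set m := μ.real (Icc (x - 1 / 2) (x + 1 / 2)) with hm
  have hm0 : 0 ≤ m := measureReal_nonneg
  have hpos : 0 < 1 / (m + 1) := by positivity
  have hle : 1 / (m + 1) ≤ 1 := by
    rw [div_le_one (by positivity)]
    linarith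
  refine ⟨1 / (m + 1), hpos, ?_⟩
  calc _ ≤ 1 / (m + 1) * m := by
        refine mul_le_mul_of_nonneg_left ?_ hpos.le
        exact measureReal_mono (Icc_subset_Icc (by linarith) (by linarith)) measure_Icc_lt_top.ne
    _ ≤ 1 := by
        rw [div_mul_eq_mul_div, div_le_one (by positivity)]
        linarith

theorem qstar_nonneg : 0 ≤ qstar μ x := by
  unfold qstar
  positivity

theorem qstar_le_of_mul_measureReal_Icc_le_one [IsFiniteMeasureOnCompacts μ] {d : ℝ} (hd : 0 < d)
    (h : d * μ.real (Icc (x - d / 2) (x + d / 2)) ≤ 1) : qstar μ x ≤ 1 / d ^ 2 := by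
  rw [qstar, dFun_eq]
  by_cases hb : BddAbove {d : ℝ | 0 ≤ d ∧ d * μ.real (Icc (x - d / 2) (x + d / 2)) ≤ 1}
  · have := le_csSup hb ⟨hd.le, h⟩
    gcongr
  · rw [Real.sSup_of_not_bddAbove hb]
    simpa using sq_nonneg d

theorem le_qstar_of_one_lt_mul_measureReal_Icc [IsFiniteMeasureOnCompacts μ] {d : ℝ} (hd : 0 < d)
    (h : 1 < d * μ.real (Icc (x - d / 2) (x + d / 2))) : 1 / d ^ 2 ≤ qstar μ x := by
  rw [qstar, dFun_eq]
  have hub : d ∈ upperBounds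
      {d : ℝ | 0 ≤ d ∧ d * μ.real (Icc (x - d / 2) (x + d / 2)) ≤ 1} := by
    rintro e ⟨-, he⟩
    by_contra! hlt
    linarith [mul_measureReal_Icc_mono μ x hd.le hlt.le]
  obtain ⟨e, he, he'⟩ := exists_pos_mul_measureReal_Icc_le_one μ x
  set S := {d : ℝ | 0 ≤ d ∧ d * μ.real (Icc (x - d / 2) (x + d / 2)) ≤ 1}
  have heS : e ∈ S := ⟨he.le, he'⟩
  have hpos : 0 < sSup S := he.trans_le (le_csSup ⟨d, hub⟩ heS)
  have hle : sSup S ≤ d := csSup_le ⟨e, heS⟩ hub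
  gcongr

/-- A trapezoidal cutoff separating two concentric intervals. -/
theorem exists_cutoff {a b : ℝ} (hab : a < b) :
    ∃ f : ℝ → ℝ, Continuous f ∧ HasCompactSupport f ∧
      ∀ ν : Measure ℝ, IsFiniteMeasureOnCompacts ν →
        ν.real (Icc (x - a / 2) (x + a / 2)) ≤ ∫ t, f t ∂ν ∧
        ∫ t, f t ∂ν ≤ ν.real (Icc (x - b / 2) (x + b / 2)) := by
  let f : ℝ → ℝ := fun t => max 0 (min 1 ((b - 2 * |t - x|) / (b - a)))
  have hba : 0 < b - a := sub_pos.2 hab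
  have hf : Continuous f := by fun_prop
  have hf0 : ∀ t, 0 ≤ f t := fun t => le_max_left _ _
  have hf1 : ∀ t, f t ≤ 1 := fun t => max_le zero_le_one (min_le_left _ _)
  have hin : ∀ t ∈ Icc (x - a / 2) (x + a / 2), f t = 1 := by
    intro t ht
    have habs : |t - x| ≤ a / 2 := abs_le.2 ⟨by linarith [ht.1], by linarith [ht.2]⟩
    have : 1 ≤ (b - 2 * |t - x|) / (b - a) := by
      rw [one_le_div hba]
      linarith
    simp [f, this]
  have hout : ∀ t, t ∉ Icc (x - b / 2) (x + b / 2) → f t = 0 := by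
    intro t ht
    have habs : b / 2 < |t - x| := by
      by_contra! hle
      have := abs_le.1 hle
      exact ht ⟨by linarith, by linarith⟩
    have : (b - 2 * |t - x|) / (b - a) ≤ 0 :=
      div_nonpos_of_nonpos_of_nonneg (by linarith) hba.le
    exact max_eq_left ((min_le_right _ _).trans this)
  have hc : HasCompactSupport f := HasCompactSupport.intro isCompact_Icc hout
  refine ⟨f, hf, hc, fun ν _ => ?_⟩
  have hint := hf.integrable_of_hasCompactSupport hc (μ := ν)
  have hind (u v : ℝ) : Integrable ((Icc u v).indicator (1 : ℝ → ℝ)) ν :=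
    (integrable_indicator_iff measurableSet_Icc).2
      (integrableOn_const (measure_Icc_lt_top.ne))
  rw [← integral_indicator_one measurableSet_Icc, ← integral_indicator_one measurableSet_Icc]
  refine ⟨integral_mono (hind _ _) hint fun t => ?_, integral_mono hint (hind _ _) fun t => ?_⟩
  · by_cases ht : t ∈ Icc (x - a / 2) (x + a / 2)
    · simp only [indicator_of_mem ht, hin t ht, Pi.one_apply, le_refl]
    · simpa only [indicator_of_notMem ht] using hf0 t
  · by_cases ht : t ∈ Icc (x - b / 2) (x + b / 2)
    · simpa only [indicator_of_mem ht, Pi.one_apply] using hf1 t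
    · simp only [indicator_of_notMem ht, hout t ht, le_refl]

theorem exists_pos_one_div_sq_eq {c : ℝ} (hc : 0 < c) : ∃ d : ℝ, 0 < d ∧ 1 / d ^ 2 = c :=
  ⟨1 / √c, by positivity, by rw [div_pow, Real.sq_sqrt hc.le]; simp⟩

theorem lt_of_one_div_sq_lt {d e : ℝ} (hd : 0 < d) (h : 1 / d ^ 2 < 1 / e ^ 2) :
    e < d := by
  by_contra! hle
  exact h.not_ge (by gcongr)

end Otelbaev

/-- If positive Radon measures `μ_n` converge to `μ` in the weak*-sense (tested against
continuous compactly supported functions), then the Otelbaev functions converge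
pointwise: `q*_{μ_n}(x) → q*_μ(x)` for every `x ∈ ℝ`. -/
theorem qstar_tendsto_of_weakstar (μs : ℕ → Measure ℝ) (μ : Measure ℝ)
    [∀ n, (μs n).Regular] [μ.Regular]
    (hw : ∀ f : ℝ → ℝ, Continuous f → HasCompactSupport f →
      Tendsto (fun n => ∫ x, f x ∂(μs n)) atTop (nhds (∫ x, f x ∂μ)))
    (x : ℝ) :
    Tendsto (fun n => qstar (μs n) x) atTop (nhds (qstar μ x)) := by
  refine tendsto_order.2 ⟨fun a ha => ?_, fun a ha => ?_⟩
  · rcases lt_or_ge a 0 with ha0 | ha0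
    · exact Eventually.of_forall fun n => ha0.trans_le (Otelbaev.qstar_nonneg _ _)
    obtain ⟨c₁, hac₁, hc₁⟩ := exists_between ha
    obtain ⟨c₂, hc₁₂, hc₂⟩ := exists_between hc₁
    obtain ⟨d₁, hd₁, rfl⟩ := Otelbaev.exists_pos_one_div_sq_eq (ha0.trans_lt hac₁)
    obtain ⟨d₂, hd₂, rfl⟩ :=
      Otelbaev.exists_pos_one_div_sq_eq ((ha0.trans_lt hac₁).trans hc₁₂)
    have hd : d₂ < d₁ := Otelbaev.lt_of_one_div_sq_lt hd₁ hc₁₂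
    have hgt : 1 < d₂ * μ.real (Icc (x - d₂ / 2) (x + d₂ / 2)) := by
      by_contra! hle
      exact hc₂.not_ge (Otelbaev.qstar_le_of_mul_measureReal_Icc_le_one μ x hd₂ hle)
    obtain ⟨f, hf, hfc, hfb⟩ := Otelbaev.exists_cutoff x hd
    have hlim : 1 < d₁ * ∫ t, f t ∂μ := by
      have := (hfb μ inferInstance).1
      have h0 : 0 ≤ μ.real (Icc (x - d₂ / 2) (x + d₂ / 2)) := measureReal_nonneg
      exact hgt.trans_le (by gcongr)
    filter_upwards [((hw f hf hfc).const_mul d₁).eventually_const_lt hlim] with n hn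
    refine hac₁.trans_le (Otelbaev.le_qstar_of_one_lt_mul_measureReal_Icc _ x hd₁ ?_)
    exact hn.trans_le (mul_le_mul_of_nonneg_left (hfb (μs n) inferInstance).2 hd₁.le)
  · obtain ⟨c₂, hc₂, hac₂⟩ := exists_between ha
    obtain ⟨c₁, hc₁, hc₁₂⟩ := exists_between hc₂
    have hq := Otelbaev.qstar_nonneg μ x
    obtain ⟨d₁, hd₁, rfl⟩ := Otelbaev.exists_pos_one_div_sq_eq (hq.trans_lt hc₁)
    obtain ⟨d₂, hd₂, rfl⟩ := Otelbaev.exists_pos_one_div_sq_eq (hq.trans_lt hc₂)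
    have hd : d₂ < d₁ := Otelbaev.lt_of_one_div_sq_lt hd₁ hc₁₂
    have hle : d₁ * μ.real (Icc (x - d₁ / 2) (x + d₁ / 2)) ≤ 1 := by
      by_contra! hgt
      exact hc₁.not_ge (Otelbaev.le_qstar_of_one_lt_mul_measureReal_Icc μ x hd₁ hgt)
    obtain ⟨f, hf, hfc, hfb⟩ := Otelbaev.exists_cutoff x hd
    have hlim : d₂ * ∫ t, f t ∂μ < 1 := by
      have h1 := (hfb μ inferInstance).2
      rcases le_or_gt (∫ t, f t ∂μ) 0 with h0 | h0
      · nlinarith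
      · calc d₂ * ∫ t, f t ∂μ < d₁ * ∫ t, f t ∂μ := by gcongr
          _ ≤ d₁ * μ.real (Icc (x - d₁ / 2) (x + d₁ / 2)) := by gcongr
          _ ≤ 1 := hle
    filter_upwards [((hw f hf hfc).const_mul d₂).eventually_lt_const hlim] with n hn
    refine (Otelbaev.qstar_le_of_mul_measureReal_Icc_le_one _ x hd₂ ?_).trans_lt hac₂
    exact (mul_le_mul_of_nonneg_left (hfb (μs n) inferInstance).1 hd₂.le).trans hn.le
end

section
/- Let μ be a positive Radon measure on ℝ. Then the Otelbaev function q*_μ is continuous on ℝ. -/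
open MeasureTheory Set Filter ENNReal

lemma otelbaev_subinterval {μ : Measure ℝ} {x y d e : ℝ} (he : e + 2 * |x - y| ≤ d)
    (hd : ENNReal.ofReal d * μ (Icc (x - d / 2) (x + d / 2)) ≤ 1) :
    ENNReal.ofReal e * μ (Icc (y - e / 2) (y + e / 2)) ≤ 1 := by
  have h₁ := neg_abs_le (x - y)
  have h₂ := le_abs_self (x - y)
  have h₃ := abs_nonneg (x - y)
  exact le_trans (mul_le_mul' (ENNReal.ofReal_le_ofReal (by linarith))
    (measure_mono (Icc_subset_Icc (by linarith) (by linarith)))) hd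

lemma otelbaev_bddAbove {μ : Measure ℝ} (hμ : μ ≠ 0) (x : ℝ) :
    BddAbove {d : ℝ | 0 ≤ d ∧ ENNReal.ofReal d * μ (Icc (x - d / 2) (x + d / 2)) ≤ 1} := by
  obtain ⟨n, hn⟩ : ∃ n : ℕ, μ (Metric.closedBall x n) ≠ 0 := by
    by_contra! h
    apply hμ
    rw [← Measure.measure_univ_eq_zero, ← Metric.iUnion_closedBall_nat x]
    exact measure_iUnion_null h
  refine ⟨max (2 * n) (μ (Metric.closedBall x n))⁻¹.toReal, ?_⟩
  rintro d ⟨hd, hle⟩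
  rcases le_total d (2 * n) with h | h
  · exact h.trans (le_max_left _ _)
  · refine le_trans ?_ (le_max_right _ _)
    rw [← ENNReal.ofReal_le_iff_le_toReal (ENNReal.inv_ne_top.2 hn)]
    refine ENNReal.le_inv_iff_mul_le.2 (le_trans ?_ hle)
    rw [Real.closedBall_eq_Icc]
    gcongr <;> linarith

lemma dFun_pos {μ : Measure ℝ} [IsLocallyFiniteMeasure μ] (hμ : μ ≠ 0) (x : ℝ) :
    0 < dFun μ x := by
  have hfin : μ (Icc (x - 1 / 2) (x + 1 / 2)) ≠ ∞ := isCompact_Icc.measure_ne_top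
  set m := μ (Icc (x - 1 / 2) (x + 1 / 2))
  have hm : 0 < 1 / (m.toReal + 1) := by positivity
  have hm1 : 1 / (m.toReal + 1) ≤ 1 := by
    rw [div_le_one (by positivity)]
    linarith [m.toReal_nonneg]
  refine hm.trans_le (le_csSup (otelbaev_bddAbove hμ x) ⟨hm.le, ?_⟩)
  calc
    _ ≤ ENNReal.ofReal (1 / (m.toReal + 1)) * m :=
      mul_le_mul_right (measure_mono (Icc_subset_Icc (by linarith) (by linarith))) _
    _ = ENNReal.ofReal (1 / (m.toReal + 1) * m.toReal) := by
      rw [ENNReal.ofReal_mul hm.le, ENNReal.ofReal_toReal hfin]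
    _ ≤ 1 := by
      rw [ENNReal.ofReal_le_one, one_div_mul_eq_div, div_le_one (by positivity)]
      linarith

lemma dFun_le_add {μ : Measure ℝ} (hμ : μ ≠ 0) (x y : ℝ) :
    dFun μ x ≤ dFun μ y + 2 * |x - y| := by
  refine csSup_le ⟨0, le_rfl, by simp⟩ ?_
  rintro d ⟨-, hd⟩
  rw [← sub_le_iff_le_add]
  rcases le_total 0 (d - 2 * |x - y|) with h | h
  · exact le_csSup (otelbaev_bddAbove hμ y)
      ⟨h, otelbaev_subinterval (by linarith) hd⟩
  · exact h.trans (le_csSup (otelbaev_bddAbove hμ y) ⟨le_rfl, by simp⟩)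

lemma lipschitzWith_dFun {μ : Measure ℝ} (hμ : μ ≠ 0) : LipschitzWith 2 (dFun μ) :=
  LipschitzWith.of_le_add_mul 2 fun x y => by
    simpa [Real.dist_eq] using dFun_le_add hμ x y

/-- For a positive Radon measure `μ` on `ℝ`, the Otelbaev function `q*_μ` is continuous. -/
theorem qstar_continuous (μ : Measure ℝ) [μ.Regular] : Continuous (qstar μ) := by
  rcases eq_or_ne μ 0 with rfl | hμ
  · have h (x y : ℝ) : qstar 0 x = qstar 0 y := by simp [qstar, dFun]
    exact continuous_of_const h
  · exact continuous_const.div ((lipschitzWith_dFun hμ).continuous.pow 2)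
      fun x => (pow_pos (dFun_pos hμ x) 2).ne'
end

section
/- Let μ be a positive Radon measure on ℝ, d > 0 and z ∈ ℝ. If √(q*_μ(z)) < 1/(2d), then √(q*_μ(x)) ≤ 1/d for all x ∈ [z − d/2, z + d/2]. -/
open MeasureTheory Set Filter ENNReal

/-- The set whose supremum is `dFun μ x`. -/
def admissibleLengths (μ : Measure ℝ) (x : ℝ) : Set ℝ :=
  {d : ℝ | 0 ≤ d ∧ ENNReal.ofReal d * μ (Icc (x - d / 2) (x + d / 2)) ≤ 1}

lemma dFun_eq_sSup (μ : Measure ℝ) (x : ℝ) : dFun μ x = sSup (admissibleLengths μ x) := rfl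

lemma dFun_nonneg (μ : Measure ℝ) (x : ℝ) : 0 ≤ dFun μ x :=
  Real.sSup_nonneg fun _ h => h.1

lemma sqrt_qstar (μ : Measure ℝ) (x : ℝ) : √(qstar μ x) = 1 / dFun μ x := by
  rw [qstar, Real.sqrt_div zero_le_one, Real.sqrt_one, Real.sqrt_sq (dFun_nonneg μ x)]

lemma exists_pos_mem_admissibleLengths (μ : Measure ℝ) [IsFiniteMeasureOnCompacts μ] (x : ℝ) :
    ∃ e ∈ admissibleLengths μ x, 0 < e := by
  have hM : μ (Icc (x - 1 / 2) (x + 1 / 2)) ≠ ∞ := isCompact_Icc.measure_lt_top.ne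
  set m : ℝ := (μ (Icc (x - 1 / 2) (x + 1 / 2))).toReal with hm
  have hm0 : 0 ≤ m := ENNReal.toReal_nonneg
  have he : 0 < 1 / (m + 1) := by positivity
  have he1 : 1 / (m + 1) ≤ 1 := (div_le_one (by positivity)).2 (by linarith)
  refine ⟨1 / (m + 1), ⟨he.le, ?_⟩, he⟩
  calc ENNReal.ofReal (1 / (m + 1)) * μ (Icc (x - 1 / (m + 1) / 2) (x + 1 / (m + 1) / 2))
      ≤ ENNReal.ofReal (1 / (m + 1)) * μ (Icc (x - 1 / 2) (x + 1 / 2)) := by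
        gcongr
    _ = ENNReal.ofReal (1 / (m + 1) * m) := by
        rw [ENNReal.ofReal_mul he.le, hm, ENNReal.ofReal_toReal hM]
    _ ≤ 1 := by
        rw [ENNReal.ofReal_le_one, one_div_mul_eq_div, div_le_one (by positivity)]
        linarith

lemma exists_lt_mem_admissibleLengths (μ : Measure ℝ) [IsFiniteMeasureOnCompacts μ] {x c : ℝ}
    (hc : 0 < c) (h : √(qstar μ x) < 1 / c) : ∃ e ∈ admissibleLengths μ x, c < e := by
  by_cases hb : BddAbove (admissibleLengths μ x)
  · obtain ⟨e, he, he0⟩ := exists_pos_mem_admissibleLengths μ x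
    have hD : 0 < dFun μ x := he0.trans_le (le_csSup hb he)
    rw [sqrt_qstar, one_div_lt_one_div hD hc, dFun_eq_sSup] at h
    exact exists_lt_of_lt_csSup ⟨e, he⟩ h
  · exact not_bddAbove_iff.1 hb c

lemma sqrt_qstar_le_of_mem_admissibleLengths {μ : Measure ℝ} {x d : ℝ} (hd : 0 < d)
    (h : d ∈ admissibleLengths μ x) : √(qstar μ x) ≤ 1 / d := by
  rw [sqrt_qstar]
  by_cases hb : BddAbove (admissibleLengths μ x)
  · exact one_div_le_one_div_of_le hd (le_csSup hb h)
  · rw [dFun_eq_sSup, Real.sSup_of_not_bddAbove hb, _root_.div_zero]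
    positivity

/-- Let `μ` be a positive Radon measure on `ℝ`, `d > 0` and `z ∈ ℝ`.  If
`√(q*_μ(z)) < 1/(2d)`, then `√(q*_μ(x)) ≤ 1/d` for all `x ∈ [z − d/2, z + d/2]`. -/
theorem qstar_local_bound (μ : Measure ℝ) [μ.Regular] (d : ℝ) (hd : 0 < d) (z : ℝ)
    (hz : Real.sqrt (qstar μ z) < 1 / (2 * d)) :
    ∀ x ∈ Icc (z - d / 2) (z + d / 2), Real.sqrt (qstar μ x) ≤ 1 / d := by
  rintro x ⟨hx₁, hx₂⟩
  obtain ⟨e, ⟨-, he⟩, hde⟩ := exists_lt_mem_admissibleLengths μ (by positivity) hz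
  refine sqrt_qstar_le_of_mem_admissibleLengths hd ⟨hd.le, le_trans ?_ he⟩
  exact mul_le_mul' (ENNReal.ofReal_le_ofReal (by linarith))
    (measure_mono (Icc_subset_Icc (by linarith) (by linarith)))
end

section
/- Let f : ℝ → [0, ∞) be measurable and locally integrable and let dμ(x) = f(x) dx. If there is a ∈ ℝ such that f is continuous, convex and monotonely increasing on (a, ∞), then there exists x₀ such that q*_μ(x) ≥ f(x) for all x ≥ x₀. -/
open MeasureTheory Set Filter ENNReal

theorem ConvexOn.mul_le_setIntegral_Icc {f : ℝ → ℝ} {x d : ℝ} (hd : 0 < d)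
    (hf : ConvexOn ℝ (Icc (x - d / 2) (x + d / 2)) f)
    (hc : ContinuousOn f (Icc (x - d / 2) (x + d / 2))) :
    d * f x ≤ ∫ y in Icc (x - d / 2) (x + d / 2), f y := by
  have hvol : volume.real (Icc (x - d / 2) (x + d / 2)) = d := by
    rw [Real.volume_real_Icc_of_le (by linarith)]; ring
  have hid : ∫ y in Icc (x - d / 2) (x + d / 2), y = d * x := by
    rw [integral_Icc_eq_integral_Ioc, ← intervalIntegral.integral_of_le (by linarith),
      integral_id]
    ring
  have h := hf.map_set_average_le hc isClosed_Icc (μ := volume) (f := fun y : ℝ => y)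
    (t := Icc (x - d / 2) (x + d / 2))
    (by rw [Real.volume_Icc]; simp; linarith) (by rw [Real.volume_Icc]; simp)
    (ae_restrict_mem measurableSet_Icc)
    (continuousOn_id.integrableOn_compact isCompact_Icc)
    (hc.integrableOn_compact isCompact_Icc)
  rw [setAverage_eq, setAverage_eq, hvol, hid, smul_eq_mul, smul_eq_mul,
    inv_mul_cancel_left₀ hd.ne'] at h
  calc d * f x ≤ d * (d⁻¹ * ∫ y in Icc (x - d / 2) (x + d / 2), f y) := by gcongr
    _ = _ := mul_inv_cancel_left₀ hd.ne' _

theorem ofReal_mul_withDensity_Icc_le_one_iff {f : ℝ → ℝ} (hf_nonneg : ∀ x, 0 ≤ f x)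
    (hf_loc : LocallyIntegrable f volume) {d : ℝ} (hd : 0 ≤ d) (u v : ℝ) :
    ENNReal.ofReal d * (volume.withDensity fun x => ENNReal.ofReal (f x)) (Icc u v) ≤ 1 ↔
      d * ∫ y in Icc u v, f y ≤ 1 := by
  rw [withDensity_apply _ measurableSet_Icc,
    ← ofReal_integral_eq_lintegral_ofReal (hf_loc.integrableOn_isCompact isCompact_Icc)
      (ae_of_all _ hf_nonneg), ← ENNReal.ofReal_mul hd, ENNReal.ofReal_le_one]

theorem setIntegral_Icc_mono_set {f : ℝ → ℝ} (hf_nonneg : ∀ x, 0 ≤ f x)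
    (hf_loc : LocallyIntegrable f volume) (x : ℝ) {d e : ℝ} (hde : d ≤ e) :
    ∫ y in Icc (x - d / 2) (x + d / 2), f y ≤ ∫ y in Icc (x - e / 2) (x + e / 2), f y :=
  setIntegral_mono_set (hf_loc.integrableOn_isCompact isCompact_Icc)
    (ae_of_all _ hf_nonneg)
    (Icc_subset_Icc (by linarith) (by linarith)).eventuallyLE

theorem exists_pos_mul_setIntegral_Icc_le_one {f : ℝ → ℝ} (hf_nonneg : ∀ x, 0 ≤ f x)
    (hf_loc : LocallyIntegrable f volume) (x : ℝ) :
    ∃ d : ℝ, 0 < d ∧ d * ∫ y in Icc (x - d / 2) (x + d / 2), f y ≤ 1 := by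
  set M := ∫ y in Icc (x - 1 / 2) (x + 1 / 2), f y
  have hM0 : 0 ≤ M := integral_nonneg hf_nonneg
  have hd : 0 < (M + 1)⁻¹ := by positivity
  refine ⟨(M + 1)⁻¹, hd, ?_⟩
  have h1 : (M + 1)⁻¹ ≤ 1 := inv_le_one_of_one_le₀ (by linarith)
  calc _ ≤ (M + 1)⁻¹ * M := by
        gcongr
        exact setIntegral_Icc_mono_set hf_nonneg hf_loc x h1
    _ ≤ (M + 1)⁻¹ * (M + 1) := by gcongr; linarith
    _ = 1 := inv_mul_cancel₀ (by positivity)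

theorem le_qstar_of_convexOn_Icc {f : ℝ → ℝ} (hf_nonneg : ∀ x, 0 ≤ f x)
    (hf_loc : LocallyIntegrable f volume) {x D : ℝ} (hD : 0 < D) (hDx : D ^ 2 * f x = 1)
    (hf : ConvexOn ℝ (Icc (x - D / 2) (x + D / 2)) f)
    (hc : ContinuousOn f (Icc (x - D / 2) (x + D / 2))) :
    f x ≤ qstar (volume.withDensity fun x => ENNReal.ofReal (f x)) x := by
  have hub : ∀ d ∈ {d : ℝ | 0 ≤ d ∧ ENNReal.ofReal d *
      (volume.withDensity fun x => ENNReal.ofReal (f x)) (Icc (x - d / 2) (x + d / 2)) ≤ 1},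
      d ≤ D := by
    rintro d ⟨hd0, hd⟩
    rw [ofReal_mul_withDensity_Icc_le_one_iff hf_nonneg hf_loc hd0] at hd
    by_contra! hlt
    have h1 := (hf.mul_le_setIntegral_Icc hD hc).trans
      (setIntegral_Icc_mono_set hf_nonneg hf_loc x hlt.le)
    have h2 : 0 < D * f x := pos_of_mul_pos_right (a := D) (by nlinarith) hD.le
    nlinarith [mul_le_mul_of_nonneg_left h1 hd0, mul_pos (sub_pos.2 hlt) h2]
  obtain ⟨e, he0, he⟩ := exists_pos_mul_setIntegral_Icc_le_one hf_nonneg hf_loc x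
  have hmem : e ∈ {d : ℝ | 0 ≤ d ∧ ENNReal.ofReal d *
      (volume.withDensity fun x => ENNReal.ofReal (f x)) (Icc (x - d / 2) (x + d / 2)) ≤ 1} :=
    ⟨he0.le, (ofReal_mul_withDensity_Icc_le_one_iff hf_nonneg hf_loc he0.le _ _).2 he⟩
  have hpos : 0 < dFun (volume.withDensity fun x => ENNReal.ofReal (f x)) x :=
    he0.trans_le (le_csSup ⟨D, hub⟩ hmem)
  have hle : dFun (volume.withDensity fun x => ENNReal.ofReal (f x)) x ≤ D :=
    csSup_le ⟨e, hmem⟩ hub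
  rw [qstar, le_div_iff₀ (by positivity), ← hDx, mul_comm]
  gcongr
  exact hf_nonneg x

/-- Let `dμ(x) = f(x) dx` with `f : ℝ → [0, ∞)` measurable and locally integrable.
If `f` is continuous, convex and monotonely increasing on `(a, ∞)` for some `a`, then
`q*_μ(x) ≥ f(x)` for all sufficiently large `x`. -/
theorem qstar_ge_of_convex (f : ℝ → ℝ) (hf_meas : Measurable f) (hf_nonneg : ∀ x, 0 ≤ f x)
    (hf_loc : LocallyIntegrable f volume)
    (a : ℝ) (hf_cont : ContinuousOn f (Ioi a)) (hf_conv : ConvexOn ℝ (Ioi a) f)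
    (hf_mono : MonotoneOn f (Ioi a)) :
    ∃ x₀ : ℝ, ∀ x : ℝ, x₀ ≤ x →
      f x ≤ qstar (volume.withDensity fun x => ENNReal.ofReal (f x)) x := by
  by_cases h : ∃ b > a, 0 < f b
  · obtain ⟨b, hab, hb⟩ := h
    refine ⟨b + 1 / √(f b), fun x hx => ?_⟩
    have hsb : 0 < 1 / √(f b) := by positivity
    have hbx : f b ≤ f x := hf_mono hab (mem_Ioi.2 (by linarith)) (by linarith)
    have hfx : 0 < f x := hb.trans_le hbx
    have hD : 0 < 1 / √(f x) := by positivity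
    have hDb : 1 / √(f x) ≤ 1 / √(f b) := by gcongr
    have hsub : Icc (x - 1 / √(f x) / 2) (x + 1 / √(f x) / 2) ⊆ Ioi a :=
      fun y hy => mem_Ioi.2 (by linarith [hy.1])
    refine le_qstar_of_convexOn_Icc hf_nonneg hf_loc hD ?_
      (hf_conv.subset hsub (convex_Icc _ _)) (hf_cont.mono hsub)
    rw [div_pow, one_pow, Real.sq_sqrt hfx.le, one_div_mul_cancel hfx.ne']
  · push Not at h
    refine ⟨a + 1, fun x hx => (h x (by linarith)).trans ?_⟩
    unfold qstar
    positivity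
end

section
/- Let f : ℝ → [0, ∞) be measurable and locally integrable and let dμ(x) = f(x) dx. If there is a ∈ ℝ such that f is continuous, concave and monotonely increasing on (a, ∞) and f is not identically zero on (a, ∞), then there exists x₀ such that q*_μ(x) ≤ f(x) for all x ≥ x₀. -/
open MeasureTheory Set Filter ENNReal

/-- The mean of a concave function over an interval is at most its value at the midpoint. -/
theorem ConcaveOn.intervalIntegral_le_midpoint {f : ℝ → ℝ} {s : Set ℝ} (hf : ConcaveOn ℝ s f)
    {x h : ℝ} (hh : 0 ≤ h) (hs : Icc (x - h) (x + h) ⊆ s)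
    (hint : IntervalIntegrable f volume (x - h) (x + h)) :
    ∫ t in (x - h)..(x + h), f t ≤ 2 * h * f x := by
  have hle : x - h ≤ x + h := by linarith
  have hrefl : ∫ t in (x - h)..(x + h), f (2 * x - t) = ∫ t in (x - h)..(x + h), f t := by
    rw [intervalIntegral.integral_comp_sub_left]
    congr 1 <;> ring
  have hint' : IntervalIntegrable (fun t => f (2 * x - t)) volume (x - h) (x + h) := by
    have := (hint.comp_sub_left (2 * x)).symm
    convert this using 1 <;> ring
  have hsum : ∫ t in (x - h)..(x + h), (f t + f (2 * x - t)) ≤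
      ∫ _ in (x - h)..(x + h), 2 * f x := by
    refine intervalIntegral.integral_mono_on hle (hint.add hint') (by simp) fun t ht => ?_
    have hmid := hf.2 (hs ht) (hs (show 2 * x - t ∈ Icc (x - h) (x + h) from
      ⟨by linarith [ht.2], by linarith [ht.1]⟩)) (show (0 : ℝ) ≤ 1 / 2 by norm_num)
      (show (0 : ℝ) ≤ 1 / 2 by norm_num) (by norm_num)
    simp only [smul_eq_mul] at hmid
    rw [show 1 / 2 * t + 1 / 2 * (2 * x - t) = x by ring] at hmid
    linarith
  rw [intervalIntegral.integral_add hint hint', hrefl, intervalIntegral.integral_const,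
    smul_eq_mul] at hsum
  linarith

/-- A window width `D > 0` with `D · μ([x - D/2, x + D/2]) ≤ 1` bounds `q*_μ(x)` by `1 / D²`. -/
theorem qstar_le_one_div_sq {μ : Measure ℝ} {x D : ℝ} (hD : 0 < D)
    (h : ENNReal.ofReal D * μ (Icc (x - D / 2) (x + D / 2)) ≤ 1) :
    qstar μ x ≤ 1 / D ^ 2 := by
  unfold qstar dFun
  by_cases hb : BddAbove {d : ℝ | 0 ≤ d ∧ ENNReal.ofReal d * μ (Icc (x - d / 2) (x + d / 2)) ≤ 1}
  · have := le_csSup hb (show D ∈ _ from ⟨hD.le, h⟩)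
    gcongr
  · rw [Real.sSup_of_not_bddAbove hb]
    simp only [ne_eq, OfNat.ofNat_ne_zero, not_false_eq_true, zero_pow, _root_.div_zero]
    positivity

/-- Let `dμ(x) = f(x) dx` with `f : ℝ → [0, ∞)` measurable and locally integrable.
If `f` is continuous, concave and monotonely increasing on `(a, ∞)` for some `a`, and
`f` is not identically zero on `(a, ∞)`, then `q*_μ(x) ≤ f(x)` for all sufficiently
large `x`. -/
theorem qstar_le_of_concave (f : ℝ → ℝ) (hf_meas : Measurable f) (hf_nonneg : ∀ x, 0 ≤ f x)
    (hf_loc : LocallyIntegrable f volume)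
    (a : ℝ) (hf_cont : ContinuousOn f (Ioi a)) (hf_conc : ConcaveOn ℝ (Ioi a) f)
    (hf_mono : MonotoneOn f (Ioi a)) (hf_ne : ∃ x ∈ Ioi a, f x ≠ 0) :
    ∃ x₀ : ℝ, ∀ x : ℝ, x₀ ≤ x →
      qstar (volume.withDensity fun x => ENNReal.ofReal (f x)) x ≤ f x := by
  obtain ⟨x₁, hx₁, hne⟩ := hf_ne
  have hpos : 0 < f x₁ := lt_of_le_of_ne (hf_nonneg x₁) hne.symm
  have hs₁ : 0 < √(f x₁) := Real.sqrt_pos.2 hpos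
  refine ⟨x₁ + 1 / √(f x₁), fun x hx => ?_⟩
  have hx₁x : x₁ ≤ x := le_trans (by simp [hs₁.le]) hx
  have hax : x ∈ Ioi a := lt_of_lt_of_le hx₁ hx₁x
  have hmono : f x₁ ≤ f x := hf_mono hx₁ hax hx₁x
  have hfx : 0 < f x := hpos.trans_le hmono
  have hs : 0 < √(f x) := Real.sqrt_pos.2 hfx
  obtain ⟨D, hDdef⟩ : ∃ D, D = 1 / √(f x) := ⟨_, rfl⟩
  have hD : 0 < D := by rw [hDdef]; positivity
  have hD2 : D ^ 2 * f x = 1 := by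
    rw [hDdef, div_pow, Real.sq_sqrt hfx.le]
    field_simp
  have hDle : D ≤ 1 / √(f x₁) := by
    rw [hDdef]
    gcongr
  have hsub : Icc (x - D / 2) (x + D / 2) ⊆ Ioi a := fun t ht => by
    have h₁ : a < x₁ := hx₁
    have h₂ := ht.1
    show a < t
    linarith
  have hle : x - D / 2 ≤ x + D / 2 := by linarith
  have hintOn : IntegrableOn f (Icc (x - D / 2) (x + D / 2)) :=
    hf_loc.integrableOn_isCompact isCompact_Icc
  have hbound : ∫ t in Icc (x - D / 2) (x + D / 2), f t ≤ D * f x := by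
    rw [integral_Icc_eq_integral_Ioc, ← intervalIntegral.integral_of_le hle]
    refine (hf_conc.intervalIntegral_le_midpoint (by positivity) hsub ?_).trans_eq (by ring)
    exact (intervalIntegrable_iff_integrableOn_Icc_of_le hle).2 hintOn
  have hkey : qstar (volume.withDensity fun x => ENNReal.ofReal (f x)) x ≤ 1 / D ^ 2 := by
    refine qstar_le_one_div_sq hD ?_
    rw [withDensity_apply _ measurableSet_Icc,
      ← ofReal_integral_eq_lintegral_ofReal hintOn (Eventually.of_forall hf_nonneg),
      ← ENNReal.ofReal_mul hD.le, ENNReal.ofReal_le_one]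
    nlinarith
  refine hkey.trans_eq ?_
  rw [div_eq_iff (by positivity), mul_comm, hD2]
end

section
/- Let β ≥ 0, μ = μ₊ − μ₋ ∈ 𝔐_β and λ ≥ 0. Set t = √(4λ + 9β² + 12β) + 3β. Then every linear subspace L of D(a_μ) such that a_μ(f, f) < λ‖f‖² for every f ∈ L with f ≠ 0 has dimension at most t·Leb({x ∈ ℝ : q*_{μ₊}(x) ≤ t²}). (By Glazman's lemma this says N(λ, H_μ) ≤ t·Leb({x ∈ ℝ : q*_{μ₊}(x) ≤ t²}).) -/
open MeasureTheory Set Filter ENNReal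

/-- `L` is a linear subspace of `D(a_μ)` on which `a_μ(f, f) < λ·‖f‖²` for every
nonzero `f ∈ L` (the class of subspaces appearing in Glazman's lemma). -/
def GoodSubspace (μp μm : Measure ℝ) (lam : ℝ) (L : Submodule ℂ (ℝ → ℂ)) : Prop :=
  (∀ f ∈ L, ∃ g, MemDom μp f g) ∧
    ∀ f ∈ L, f ≠ 0 → ∀ g : ℝ → ℂ, MemDom μp f g →
      formQ μp μm f g < lam * (sqInt volume f).toReal

/-- Cauchy–Schwarz for the oscillation of an indefinite integral on an interval of length `h`. -/
lemma enorm_sub_sq_le {f g : ℝ → ℂ} (hg : LocallyIntegrable g volume)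
    (hfg : ∀ a b : ℝ, f b - f a = ∫ x in a..b, g x) {a h x y : ℝ}
    (hx : x ∈ Ico a (a + h)) (hy : y ∈ Ico a (a + h)) :
    ‖f x - f y‖ₑ ^ 2 ≤ ENNReal.ofReal h * ∫⁻ z in Ico a (a + h), ‖g z‖ₑ ^ 2 := by
  have hsub : uIoc y x ⊆ Ico a (a + h) := by
    intro z hz
    rcases mem_uIoc.1 hz with hz | hz
    · exact ⟨hy.1.trans hz.1.le, hz.2.trans_lt hx.2⟩
    · exact ⟨hx.1.trans hz.1.le, hz.2.trans_lt hy.2⟩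
  have h1 : ‖f x - f y‖ₑ ≤ ∫⁻ z in Ico a (a + h), ‖g z‖ₑ := by
    rw [hfg, ← ofReal_norm, intervalIntegral.norm_intervalIntegral_eq,
      ofReal_norm]
    exact (enorm_integral_le_lintegral_enorm _).trans (lintegral_mono_set hsub)
  have h2 := ENNReal.lintegral_mul_le_Lp_mul_Lq (volume.restrict (Ico a (a + h)))
    Real.HolderConjugate.two_two (f := fun _ => (1 : ℝ≥0∞)) (g := fun z => ‖g z‖ₑ)
    aemeasurable_const hg.aestronglyMeasurable.restrict.enorm
  simp only [Pi.mul_apply, one_mul, one_pow, lintegral_const, Measure.restrict_apply_univ,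
    Real.volume_Ico, add_sub_cancel_left, ENNReal.rpow_two] at h2
  calc ‖f x - f y‖ₑ ^ 2
      ≤ (ENNReal.ofReal h ^ (1 / 2 : ℝ) *
          (∫⁻ z in Ico a (a + h), ‖g z‖ₑ ^ 2) ^ (1 / 2 : ℝ)) ^ 2 := by
        gcongr
        exact h1.trans h2
    _ = ENNReal.ofReal h * ∫⁻ z in Ico a (a + h), ‖g z‖ₑ ^ 2 := by
        rw [mul_pow, ← ENNReal.rpow_mul_natCast, ← ENNReal.rpow_mul_natCast]
        norm_num

lemma enorm_sq_le_two_mul (z w : ℂ) : ‖z‖ₑ ^ 2 ≤ 2 * ‖w‖ₑ ^ 2 + 2 * ‖z - w‖ₑ ^ 2 := by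
  simp only [← ofReal_norm]
  rw [← ENNReal.ofReal_pow (norm_nonneg _), ← ENNReal.ofReal_pow (norm_nonneg _),
    ← ENNReal.ofReal_pow (norm_nonneg _), ← ENNReal.ofReal_ofNat, ← ENNReal.ofReal_mul (by simp),
    ← ENNReal.ofReal_mul (by simp), ← ENNReal.ofReal_add (by positivity) (by positivity)]
  refine ENNReal.ofReal_le_ofReal ?_
  have h1 : ‖z‖ ≤ ‖w‖ + ‖z - w‖ := by simpa using norm_add_le w (z - w)
  nlinarith [norm_nonneg z, norm_nonneg w, norm_nonneg (z - w), sq_nonneg (‖w‖ - ‖z - w‖)]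

/-- A measure bounded by `β` on unit intervals is bounded by `β (h + 1)` on intervals of
length `h`. -/
lemma measure_Ico_le_of_unit {ν : Measure ℝ} {β : ℝ}
    (hν : ∀ x : ℝ, ν (Icc x (x + 1)) ≤ ENNReal.ofReal β) {a h : ℝ} (hh : 0 < h) :
    ν (Ico a (a + h)) ≤ ENNReal.ofReal (h + 1) * ENNReal.ofReal β := by
  have hsub : Ico a (a + h) ⊆ ⋃ i ∈ Finset.range ⌈h⌉₊, Icc (a + i) (a + i + 1) := by
    intro z hz
    simp only [mem_iUnion, Finset.mem_range, exists_prop]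
    have hz0 : 0 ≤ z - a := sub_nonneg.2 hz.1
    refine ⟨⌊z - a⌋₊, ?_, ?_, ?_⟩
    · rw [Nat.lt_ceil]
      linarith [Nat.floor_le hz0, hz.2]
    · linarith [Nat.floor_le hz0]
    · linarith [Nat.lt_floor_add_one (z - a)]
  calc ν (Ico a (a + h)) ≤ ∑ i ∈ Finset.range ⌈h⌉₊, ν (Icc (a + i) (a + i + 1)) :=
        (measure_mono hsub).trans (measure_biUnion_finset_le _ _)
    _ ≤ ∑ _i ∈ Finset.range ⌈h⌉₊, ENNReal.ofReal β := Finset.sum_le_sum fun i _ => hν _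
    _ = (⌈h⌉₊ : ℝ≥0∞) * ENNReal.ofReal β := by simp
    _ ≤ ENNReal.ofReal (h + 1) * ENNReal.ofReal β := by
        gcongr
        rw [← ENNReal.ofReal_natCast]
        exact ENNReal.ofReal_le_ofReal (Nat.ceil_lt_add_one hh.le).le

/-- The form inequality on a single interval of length `1 / t` on which either `μ₊` is large or
`f` vanishes somewhere. -/
lemma form_le_on_cell {μp μm : Measure ℝ} {β lam t a h : ℝ} (hβ : 0 ≤ β) (hlam : 0 ≤ lam)
    (hμm : ∀ x : ℝ, μm (Icc x (x + 1)) ≤ ENNReal.ofReal β)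
    (ht0 : 0 < t) (hth : t * h = 1) (hcoef : lam * h + (h + 1) * β ≤ t / 2)
    {f g : ℝ → ℂ} (hg : LocallyIntegrable g volume)
    (hfg : ∀ a b : ℝ, f b - f a = ∫ x in a..b, g x)
    (hcell : ENNReal.ofReal t ≤ μp (Ico a (a + h)) ∨ ∃ c ∈ Ico a (a + h), f c = 0) :
    ENNReal.ofReal lam * (∫⁻ x in Ico a (a + h), ‖f x‖ₑ ^ 2) +
        ∫⁻ x in Ico a (a + h), ‖f x‖ₑ ^ 2 ∂μm ≤
      (∫⁻ x in Ico a (a + h), ‖g x‖ₑ ^ 2) + ∫⁻ x in Ico a (a + h), ‖f x‖ₑ ^ 2 ∂μp := by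
  have hh : 0 < h := by
    by_contra! hneg
    nlinarith
  set I := Ico a (a + h) with hI
  set D := ∫⁻ x in I, ‖g x‖ₑ ^ 2
  set P := ∫⁻ x in I, ‖f x‖ₑ ^ 2 ∂μp
  set K : ℝ≥0∞ := ⨆ x ∈ I, ‖f x‖ₑ ^ 2
  have hIm : MeasurableSet I := measurableSet_Ico
  have hKle : ∀ x ∈ I, ‖f x‖ₑ ^ 2 ≤ K := fun x hx => le_iSup₂ (f := fun x _ => ‖f x‖ₑ ^ 2) x hx
  have hint : ∀ ν : Measure ℝ, ∫⁻ x in I, ‖f x‖ₑ ^ 2 ∂ν ≤ K * ν I := fun ν => by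
    rw [← setLIntegral_const]
    exact setLIntegral_mono' hIm hKle
  have hosc : ∀ c ∈ I, K ≤ 2 * ‖f c‖ₑ ^ 2 + 2 * (ENNReal.ofReal h * D) := fun c hc =>
    iSup₂_le fun x hx => (enorm_sq_le_two_mul (f x) (f c)).trans <| by
      gcongr
      exact enorm_sub_sq_le hg hfg hx hc
  set M : ℝ≥0∞ := (K - 2 * (ENNReal.ofReal h * D)) / 2
  have h2M : 2 * M = K - 2 * (ENNReal.ofReal h * D) :=
    ENNReal.mul_div_cancel two_ne_zero ENNReal.ofNat_ne_top
  have hMc : ∀ c ∈ I, M ≤ ‖f c‖ₑ ^ 2 := fun c hc => by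
    refine ENNReal.div_le_of_le_mul' ?_
    exact tsub_le_iff_right.2 (hosc c hc)
  have hKM : K ≤ 2 * M + 2 * (ENNReal.ofReal h * D) := by
    rw [h2M]
    exact le_tsub_add
  have htM : ENNReal.ofReal t * M ≤ P := by
    rcases hcell with hμ | ⟨c, hc, hfc⟩
    · calc ENNReal.ofReal t * M ≤ M * μp I := by rw [mul_comm]; gcongr
        _ = ∫⁻ _ in I, M ∂μp := (setLIntegral_const _ _).symm
        _ ≤ P := setLIntegral_mono' hIm hMc
    · have : M = 0 := by simpa [hfc] using hMc c hc
      simp [this]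
  have hth' : ENNReal.ofReal t * ENNReal.ofReal h = 1 := by
    rw [← ENNReal.ofReal_mul ht0.le, hth, ENNReal.ofReal_one]
  have hhalf : ENNReal.ofReal (t / 2) * 2 = ENNReal.ofReal t := by
    rw [← ENNReal.ofReal_ofNat 2, ← ENNReal.ofReal_mul (by positivity)]
    congr 1
    ring
  calc ENNReal.ofReal lam * (∫⁻ x in I, ‖f x‖ₑ ^ 2) + ∫⁻ x in I, ‖f x‖ₑ ^ 2 ∂μm
      ≤ ENNReal.ofReal lam * (K * ENNReal.ofReal h) +
          K * (ENNReal.ofReal (h + 1) * ENNReal.ofReal β) := by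
        gcongr
        · exact (hint volume).trans_eq (by simp [hI])
        · refine (hint μm).trans ?_
          gcongr
          exact measure_Ico_le_of_unit hμm hh
    _ = ENNReal.ofReal (lam * h + (h + 1) * β) * K := by
        rw [ENNReal.ofReal_add (p := lam * h) (by positivity) (by positivity),
          ENNReal.ofReal_mul hlam, ENNReal.ofReal_mul (p := h + 1) (by positivity)]
        ring
    _ ≤ ENNReal.ofReal (t / 2) * (2 * M + 2 * (ENNReal.ofReal h * D)) := by gcongr
    _ = ENNReal.ofReal (t / 2) * 2 * M + ENNReal.ofReal (t / 2) * 2 * ENNReal.ofReal h * D := by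
        ring
    _ = ENNReal.ofReal t * M + D := by rw [hhalf, hth', one_mul]
    _ ≤ D + P := by
        rw [add_comm]
        gcongr

lemma sqInt_eq_tsum_cells (ν : Measure ℝ) (f : ℝ → ℂ) {h : ℝ} (hh : 0 < h) (s : ℝ) :
    sqInt ν f = ∑' k : ℤ, ∫⁻ x in Ico (s + k • h) (s + k • h + h), ‖f x‖ₑ ^ 2 ∂ν := by
  have hcell : ∀ k : ℤ, Ico (s + k • h) (s + k • h + h) = Ico (s + k • h) (s + (k + 1) • h) := by
    intro k
    rw [add_smul, one_smul, add_assoc]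
  simp_rw [hcell]
  rw [← lintegral_iUnion (fun _ => measurableSet_Ico) (pairwise_disjoint_Ico_add_zsmul s h),
    iUnion_Ico_add_zsmul hh, setLIntegral_univ]
  rfl

lemma form_le_of_cells {μp μm : Measure ℝ} {β lam t h : ℝ} (hβ : 0 ≤ β) (hlam : 0 ≤ lam)
    (hμm : ∀ x : ℝ, μm (Icc x (x + 1)) ≤ ENNReal.ofReal β)
    (ht0 : 0 < t) (hth : t * h = 1) (hcoef : lam * h + (h + 1) * β ≤ t / 2) (s : ℝ)
    {f g : ℝ → ℂ} (hfg : MemDom μp f g)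
    (hcell : ∀ k : ℤ, μp (Ico (s + k • h) (s + k • h + h)) < ENNReal.ofReal t →
      f (s + k • h) = 0) :
    ENNReal.ofReal lam * sqInt volume f + sqInt μm f ≤ sqInt volume g + sqInt μp f := by
  have hh : 0 < h := by
    by_contra! hneg
    nlinarith
  simp_rw [sqInt_eq_tsum_cells _ _ hh s]
  rw [← ENNReal.tsum_mul_left, ← ENNReal.tsum_add, ← ENNReal.tsum_add]
  refine ENNReal.tsum_le_tsum fun k => ?_
  refine form_le_on_cell hβ hlam hμm ht0 hth hcoef hfg.locInt hfg.fund ?_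
  rcases le_or_gt (ENNReal.ofReal t) (μp (Ico (s + k • h) (s + k • h + h))) with hk | hk
  · exact Or.inl hk
  · exact Or.inr ⟨_, ⟨le_rfl, by linarith⟩, hcell k hk⟩

lemma le_formQ_of_le {μp μm : Measure ℝ} {lam : ℝ} (hlam : 0 ≤ lam) {f g : ℝ → ℂ}
    (hfg : MemDom μp f g)
    (hle : ENNReal.ofReal lam * sqInt volume f + sqInt μm f ≤ sqInt volume g + sqInt μp f) :
    lam * (sqInt volume f).toReal ≤ formQ μp μm f g := by
  have hfin : sqInt volume g + sqInt μp f ≠ ⊤ :=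
    ENNReal.add_ne_top.2 ⟨hfg.g_L2.ne, hfg.f_mu.ne⟩
  have hfin' := ENNReal.add_ne_top.1 (ne_top_of_le_ne_top hfin hle)
  have := ENNReal.toReal_mono hfin hle
  rw [ENNReal.toReal_add hfin'.1 hfin'.2, ENNReal.toReal_add hfg.g_L2.ne hfg.f_mu.ne,
    ENNReal.toReal_mul, ENNReal.toReal_ofReal hlam] at this
  unfold formQ
  linarith

/-- If the only function in `L` vanishing at all points `p k`, `k ∈ S`, is zero, then
`dim L ≤ #S`. -/
lemma toENat_rank_le_encard {ι : Type} (L : Submodule ℂ (ℝ → ℂ)) (S : Set ι) (p : ι → ℝ)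
    (hL : ∀ f ∈ L, (∀ k ∈ S, f (p k) = 0) → f = 0) :
    Cardinal.toENat (Module.rank ℂ L) ≤ S.encard := by
  rcases S.finite_or_infinite with hS | hS
  · have := hS.fintype
    let T : L →ₗ[ℂ] (S → ℂ) := (LinearMap.funLeft ℂ ℂ fun k : S => p k).comp L.subtype
    have hT : Function.Injective T := by
      rw [injective_iff_map_eq_zero]
      intro f hf
      exact Subtype.ext (hL f f.2 fun k hk => congrFun hf ⟨k, hk⟩)
    have hrank := LinearMap.rank_le_of_injective T hT
    rw [rank_fun'] at hrank
    rw [encard_eq_coe_toFinset_card, toFinset_card]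
    exact Cardinal.toENat_le_natCast.2 hrank
  · rw [hS.encard_eq]
    exact le_top

/-- Averaging over translates of a lattice: a constant bounding from below the number of points
of every translate in `C` is at most the density-normalised volume of `C`. -/
lemma ofReal_mul_le_volume_of_encard {C : Set ℝ} (hC : MeasurableSet C) {h : ℝ} (hh : 0 < h)
    {N : ℝ≥0∞} (hN : ∀ s : ℝ, N ≤ ({k : ℤ | s + k • h ∈ C}.encard : ℝ≥0∞)) :
    ENNReal.ofReal h * N ≤ volume C := by
  have hcount : ∀ s : ℝ, N ≤ ∑' γ : AddSubgroup.zmultiples h, C.indicator 1 (γ +ᵥ s) := by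
    intro s
    refine (hN s).trans_eq ?_
    rw [← ENNReal.tsum_set_one, tsum_subtype {k : ℤ | s + k • h ∈ C} (fun _ => (1 : ℝ≥0∞))]
    let e : ℤ ≃ AddSubgroup.zmultiples h :=
      Equiv.ofInjective (fun n : ℤ => n • h) (zsmul_left_strictMono hh).injective
    rw [← e.tsum_eq]
    refine tsum_congr fun k => ?_
    have : e k +ᵥ s = s + k • h := add_comm _ _
    rw [this]
    rfl
  have hmeas : Measurable (C.indicator (1 : ℝ → ℝ≥0∞)) := measurable_one.indicator hC
  calc ENNReal.ofReal h * N = ∫⁻ _ in Ioc 0 (0 + h), N := by simp [mul_comm]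
    _ ≤ ∫⁻ s in Ioc 0 (0 + h), ∑' γ : AddSubgroup.zmultiples h, C.indicator 1 (γ +ᵥ s) :=
        lintegral_mono hcount
    _ = ∑' γ : AddSubgroup.zmultiples h, ∫⁻ s in Ioc 0 (0 + h), C.indicator 1 (γ +ᵥ s) :=
        lintegral_tsum fun γ => (hmeas.comp (measurable_const_vadd γ)).aemeasurable
    _ = ∫⁻ x, C.indicator 1 x :=
        ((isAddFundamentalDomain_Ioc hh 0).lintegral_eq_tsum'' _).symm
    _ = volume C := lintegral_indicator_one hC

lemma measurable_measure_Ico (μ : Measure ℝ) [SFinite μ] (h : ℝ) :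
    Measurable fun x : ℝ => μ (Ico x (x + h)) := by
  have hs : MeasurableSet {p : ℝ × ℝ | p.1 ≤ p.2 ∧ p.2 < p.1 + h} :=
    (measurableSet_le measurable_fst measurable_snd).inter
      (measurableSet_lt measurable_snd (measurable_fst.add_const h))
  exact measurable_measure_prodMk_left hs

lemma bddAbove_dFun_set {μ : Measure ℝ} (hμ : μ univ ≠ 0) (x : ℝ) :
    BddAbove {d : ℝ | 0 ≤ d ∧ ENNReal.ofReal d * μ (Icc (x - d / 2) (x + d / 2)) ≤ 1} := by
  have hU : ⋃ n : ℕ, Icc (x - n) (x + n) = univ := by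
    refine eq_univ_of_forall fun y => mem_iUnion.2 ?_
    obtain ⟨n, hn⟩ := exists_nat_ge |y - x|
    have := abs_le.1 hn
    exact ⟨n, by linarith, by linarith⟩
  obtain ⟨n, hn⟩ : ∃ n : ℕ, μ (Icc (x - n) (x + n)) ≠ 0 := by
    by_contra! hzero
    exact hμ (hU ▸ measure_iUnion_null hzero)
  set m := μ (Icc (x - n) (x + n))
  refine ⟨max (2 * n) (m⁻¹).toReal, fun d hd => ?_⟩
  by_contra! hlt
  obtain ⟨h1, h2⟩ := max_lt_iff.1 hlt
  have hsub : Icc (x - n) (x + n) ⊆ Icc (x - d / 2) (x + d / 2) :=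
    Icc_subset_Icc (by linarith) (by linarith)
  have hle : ENNReal.ofReal d * m ≤ 1 := (mul_le_mul_right (measure_mono hsub) _).trans hd.2
  have hle' : ENNReal.ofReal d ≤ m⁻¹ := ENNReal.le_inv_iff_mul_le.2 hle
  have := ENNReal.toReal_mono (ENNReal.inv_ne_top.2 hn) hle'
  rw [ENNReal.toReal_ofReal hd.1] at this
  linarith

/-- If the half-open interval of length `1 / t` centred at `x` has `μ`-mass less than `t`, then
`q*_μ(x) ≤ t²`. -/
lemma qstar_le_of_measure_Ico_lt {μ : Measure ℝ} (hμ : μ univ ≠ 0) {t h : ℝ} (ht0 : 0 < t)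
    (hth : t * h = 1) {x : ℝ} (hx : μ (Ico (x - h / 2) (x - h / 2 + h)) < ENNReal.ofReal t) :
    qstar μ x ≤ t ^ 2 := by
  have hh : 0 < h := by
    by_contra! hneg
    nlinarith
  have hd : h ≤ dFun μ x := by
    refine le_of_forall_lt_imp_le_of_dense fun d hdh => ?_
    rcases lt_or_ge d 0 with hd0 | hd0
    · exact hd0.le.trans (Real.sSup_nonneg fun _ h => h.1)
    · refine le_csSup (bddAbove_dFun_set hμ x) ⟨hd0, ?_⟩
      calc ENNReal.ofReal d * μ (Icc (x - d / 2) (x + d / 2))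
          ≤ ENNReal.ofReal h * ENNReal.ofReal t := by
            gcongr
            refine (measure_mono ?_).trans hx.le
            intro y hy
            exact ⟨by linarith [hy.1], by linarith [hy.2]⟩
        _ = 1 := by rw [← ENNReal.ofReal_mul hh.le, mul_comm, hth, ENNReal.ofReal_one]
  calc qstar μ x ≤ 1 / h ^ 2 := by
        unfold qstar
        gcongr
    _ = t ^ 2 := by
        rw [div_eq_iff (by positivity), ← mul_pow, hth, one_pow]

lemma measure_eq_zero_of_unit {ν : Measure ℝ} (hν : ∀ x : ℝ, ν (Icc x (x + 1)) = 0) : ν = 0 := by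
  rw [← Measure.measure_univ_eq_zero, ← iUnion_Icc_add_intCast (0 : ℝ)]
  exact measure_iUnion_null fun n => hν _

/-- Upper bound for the spectral distribution function: for `μ = μ₊ − μ₋ ∈ 𝔐_β`,
`λ ≥ 0` and `t = √(4λ + 9β² + 12β) + 3β`, every linear subspace `L ⊆ D(a_μ)` with
`a_μ(f, f) < λ‖f‖²` for all nonzero `f ∈ L` has dimension at most
`t·Leb({x : q*_{μ₊}(x) ≤ t²})`; i.e. `N(λ, H_μ) ≤ t·Leb({x : q*_{μ₊}(x) ≤ t²})`. -/
theorem spectral_upper_bound (β : ℝ) (hβ : 0 ≤ β)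
    (μp μm : Measure ℝ) [μp.Regular] [μm.Regular]
    (hμp : μp univ ≠ 0)
    (hμm : ∀ x : ℝ, μm (Icc x (x + 1)) ≤ ENNReal.ofReal β)
    (lam : ℝ) (hlam : 0 ≤ lam)
    (t : ℝ) (ht : t = Real.sqrt (4 * lam + 9 * β ^ 2 + 12 * β) + 3 * β)
    (L : Submodule ℂ (ℝ → ℂ)) (hL : GoodSubspace μp μm lam L) :
    ((Module.rank ℂ ↥L).toENat : ℝ≥0∞) ≤
      ENNReal.ofReal t * volume {x : ℝ | qstar μp x ≤ t ^ 2} := by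
  have hroot : 0 ≤ 4 * lam + 9 * β ^ 2 + 12 * β := by positivity
  have hsq := Real.sq_sqrt hroot
  have hsq0 := Real.sqrt_nonneg (4 * lam + 9 * β ^ 2 + 12 * β)
  have ht_nonneg : 0 ≤ t := by rw [ht]; positivity
  rcases ht_nonneg.eq_or_lt with ht0 | ht0
  · have hβ0 : β = 0 := by linarith
    have hlam0 : lam = 0 := by
      subst hβ0
      nlinarith
    have hμm0 : μm = 0 := measure_eq_zero_of_unit fun x => by simpa [hβ0] using hμm x
    have hrank := toENat_rank_le_encard L (∅ : Set ℤ) (fun _ => 0) fun f hf _ => by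
      by_contra hne
      obtain ⟨g, hg⟩ := hL.1 f hf
      refine (hL.2 f hf hne g hg).not_ge (le_formQ_of_le hlam hg ?_)
      simp [hlam0, hμm0, sqInt]
    simp only [encard_empty, nonpos_iff_eq_zero] at hrank
    simp [hrank]
  · obtain ⟨h, hth⟩ : ∃ h, t * h = 1 := ⟨t⁻¹, mul_inv_cancel₀ ht0.ne'⟩
    have hh : 0 < h := by
      by_contra! hneg
      nlinarith
    have hquad : t ^ 2 = 4 * lam + 12 * β + 6 * β * t := by
      have : Real.sqrt (4 * lam + 9 * β ^ 2 + 12 * β) = t - 3 * β := by linarith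
      rw [this] at hsq
      linarith
    have hcoef : lam * h + (h + 1) * β ≤ t / 2 := by
      have hmul : t = 4 * (lam * h) + 12 * (β * h) + 6 * β := by
        linear_combination h * hquad + (6 * β - t) * hth
      nlinarith [mul_nonneg hlam hh.le, mul_nonneg hβ hh.le]
    set C : Set ℝ := {x | μp (Ico x (x + h)) < ENNReal.ofReal t} with hC
    have hCm : MeasurableSet C := measurableSet_lt (measurable_measure_Ico μp h) measurable_const
    have hN : ∀ s : ℝ, ((Module.rank ℂ L).toENat : ℝ≥0∞) ≤
        ({k : ℤ | s + k • h ∈ C}.encard : ℝ≥0∞) := by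
      intro s
      refine ENat.toENNReal_le.2 (toENat_rank_le_encard L _ (fun k => s + k • h) ?_)
      intro f hf hzero
      by_contra hne
      obtain ⟨g, hg⟩ := hL.1 f hf
      exact (hL.2 f hf hne g hg).not_ge (le_formQ_of_le hlam hg
        (form_le_of_cells hβ hlam hμm ht0 hth hcoef s hg hzero))
    have hvol : volume C ≤ volume {x : ℝ | qstar μp x ≤ t ^ 2} := by
      rw [← measure_preimage_add_right volume (-(h / 2)) C]
      refine measure_mono fun x hx => qstar_le_of_measure_Ico_lt hμp ht0 hth ?_
      simpa only [hC, mem_preimage, mem_ofPred_eq, ← sub_eq_add_neg] using hx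
    calc ((Module.rank ℂ L).toENat : ℝ≥0∞)
        = ENNReal.ofReal t * (ENNReal.ofReal h * (Module.rank ℂ L).toENat) := by
          rw [← mul_assoc, ← ENNReal.ofReal_mul ht0.le, hth, ENNReal.ofReal_one, one_mul]
      _ ≤ ENNReal.ofReal t * volume {x : ℝ | qstar μp x ≤ t ^ 2} := by
          gcongr
          exact (ofReal_mul_le_volume_of_encard hCm hh hN).trans hvol
end

section
/- Let β ≥ 0, μ = μ₊ − μ₋ ∈ 𝔐_β, and let l > 0 and α ≥ 0 be constants such that μ₋(I) ≥ α for every interval I ⊂ ℝ of length at least l. Let λ ≥ 0 and set c = 3(α/l + 2λ)/(16(π² + 1)(αl + 2)). Then the supremum of the dimensions of linear subspaces L of D(a_μ) satisfying a_μ(f, f) < λ‖f‖² for every f ∈ L with f ≠ 0 is at least 2√c·Leb({x ∈ ℝ : q*_{μ₊}(x) < c}). (By Glazman's lemma this says N(λ, H_μ) ≥ 2√c·Leb({x ∈ ℝ : q*_{μ₊}(x) < c}).) -/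
open MeasureTheory Set Filter ENNReal

/-- The variational eigenvalue counting function: the supremum of the dimensions of
linear subspaces `L ⊆ D(a_μ)` with `a_μ(f, f) < λ‖f‖²` for all nonzero `f ∈ L`.
By Glazman's lemma this equals `N(λ, H_μ)`. -/
noncomputable def NVar (μp μm : Measure ℝ) (lam : ℝ) : ℝ≥0∞ :=
  ⨆ L : {L : Submodule ℂ (ℝ → ℂ) // GoodSubspace μp μm lam L},
    ((Module.rank ℂ ↥(L : Submodule ℂ (ℝ → ℂ))).toENat : ℝ≥0∞)

/-- Greedy selection: a set of measure larger than `n * r` contains `n + 1` points with mutual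
distances at least `r`. -/
lemma exists_separated_of_bddBelow {r : ℝ} (hr : 0 ≤ r) (n : ℕ) :
    ∀ S : Set ℝ, BddBelow S → n * ENNReal.ofReal r < volume S →
      ∃ T : Finset ℝ, ↑T ⊆ S ∧ T.card = n + 1 ∧ ∀ x ∈ T, ∀ y ∈ T, x ≠ y → r ≤ |x - y| := by
  induction n with
  | zero =>
    intro S _ hS
    obtain ⟨x, hx⟩ : S.Nonempty := by
      rw [nonempty_iff_ne_empty]
      rintro rfl
      simp at hS
    refine ⟨{x}, by simpa using hx, by simp, ?_⟩
    intro a ha b hb hab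
    simp only [Finset.mem_singleton] at ha hb
    exact absurd (ha.trans hb.symm) hab
  | succ n ih =>
    intro S hb hS
    have hne : S.Nonempty := by
      rw [nonempty_iff_ne_empty]
      rintro rfl
      simp at hS
    obtain ⟨ε, hε, hεS⟩ : ∃ ε : ℝ, 0 < ε ∧
        (n + 1 : ℕ) * ENNReal.ofReal r + ENNReal.ofReal ε < volume S := by
      obtain ⟨e, he, h⟩ := ENNReal.lt_iff_exists_add_pos_lt.1 hS
      exact ⟨e, he, by simpa using h⟩
    obtain ⟨x, hxS, hx⟩ := exists_lt_of_csInf_lt hne (lt_add_of_pos_right (sInf S) hε)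
    have hcover : S ⊆ Ico (sInf S) (x + r) ∪ S ∩ Ici (x + r) := by
      intro y hy
      rcases lt_or_ge y (x + r) with h | h
      · exact Or.inl ⟨csInf_le hb hy, h⟩
      · exact Or.inr ⟨hy, h⟩
    have hvol : n * ENNReal.ofReal r < volume (S ∩ Ici (x + r)) := by
      by_contra! hcon
      refine absurd hεS (not_lt.2 ?_)
      calc volume S ≤ volume (Ico (sInf S) (x + r)) + volume (S ∩ Ici (x + r)) :=
            (measure_mono hcover).trans (measure_union_le _ _)
        _ ≤ ENNReal.ofReal (r + ε) + n * ENNReal.ofReal r := by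
            gcongr
            rw [Real.volume_Ico]
            exact ENNReal.ofReal_le_ofReal (by linarith)
        _ = (n + 1 : ℕ) * ENNReal.ofReal r + ENNReal.ofReal ε := by
            rw [ENNReal.ofReal_add hr hε.le]
            push_cast
            ring
    obtain ⟨T, hTS, hTc, hT⟩ := ih _ (hb.mono inter_subset_left) hvol
    by_cases hxT : x ∈ T
    · have hr0 : r = 0 := by
        have := (hTS hxT).2
        simp only [mem_Ici] at this
        linarith
      subst hr0
      obtain ⟨U, hUS, hUc⟩ : ∃ U : Finset ℝ, ↑U ⊆ S ∧ U.card = n + 1 + 1 := by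
        have hinf : S.Infinite := by
          intro hfin
          rw [hfin.measure_zero] at hS
          simp at hS
        exact hinf.exists_subset_card_eq _
      exact ⟨U, hUS, hUc, fun _ _ _ _ _ => abs_nonneg _⟩
    have hdist : ∀ y ∈ T, r ≤ y - x := fun y hy => by
      have := (hTS hy).2
      simp only [mem_Ici] at this
      linarith
    refine ⟨insert x T, ?_, by rw [Finset.card_insert_of_notMem hxT, hTc], ?_⟩
    · rw [Finset.coe_insert]
      exact insert_subset hxS (hTS.trans inter_subset_left)
    · intro a ha b hb hab
      rcases Finset.mem_insert.1 ha with rfl | ha' <;>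
        rcases Finset.mem_insert.1 hb with rfl | hb'
      · exact absurd rfl hab
      · rw [abs_sub_comm]
        exact (hdist b hb').trans (le_abs_self _)
      · exact (hdist a ha').trans (le_abs_self _)
      · exact hT a ha' b hb' hab

lemma exists_separated {r : ℝ} (hr : 0 ≤ r) (n : ℕ) (S : Set ℝ)
    (hS : n * ENNReal.ofReal r < volume S) :
    ∃ T : Finset ℝ, ↑T ⊆ S ∧ T.card = n + 1 ∧ ∀ x ∈ T, ∀ y ∈ T, x ≠ y → r ≤ |x - y| := by
  have hmono : Monotone fun k : ℕ => S ∩ Ici (-(k : ℝ)) := fun i j hij =>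
    inter_subset_inter_right _ (Ici_subset_Ici.2 (by simpa using hij))
  have hU : ⋃ k : ℕ, S ∩ Ici (-(k : ℝ)) = S := by
    refine subset_antisymm (iUnion_subset fun _ => inter_subset_left) fun x hx => ?_
    obtain ⟨k, hk⟩ := exists_nat_ge (-x)
    exact mem_iUnion.2 ⟨k, hx, by simp only [mem_Ici]; linarith⟩
  rw [← hU, hmono.measure_iUnion] at hS
  obtain ⟨k, hk⟩ := lt_iSup_iff.1 hS
  obtain ⟨T, hT, h⟩ := exists_separated_of_bddBelow hr n _
    ⟨-(k : ℝ), fun _ hy => hy.2⟩ hk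
  exact ⟨T, hT.trans inter_subset_left, h⟩

lemma exists_pos_mul_measure_Icc_le_one (μ : Measure ℝ) [IsFiniteMeasureOnCompacts μ] (x : ℝ) :
    ∃ d : ℝ, 0 < d ∧ ENNReal.ofReal d * μ (Icc (x - d / 2) (x + d / 2)) ≤ 1 := by
  set M := μ (Icc (x - 1 / 2) (x + 1 / 2)) with hM
  have hMtop : M ≠ ⊤ := isCompact_Icc.measure_lt_top.ne
  have hM0 : (0 : ℝ) ≤ M.toReal := ENNReal.toReal_nonneg
  refine ⟨1 / (M.toReal + 1), by positivity, ?_⟩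
  have h1 : 1 / (M.toReal + 1) ≤ 1 := by
    rw [div_le_one (by positivity)]
    linarith
  calc _ ≤ ENNReal.ofReal (1 / (M.toReal + 1)) * M := by
        gcongr
        exact measure_mono (Icc_subset_Icc (by linarith) (by linarith))
    _ = ENNReal.ofReal (1 / (M.toReal + 1) * M.toReal) := by
        rw [ENNReal.ofReal_mul (by positivity), ENNReal.ofReal_toReal hMtop]
    _ ≤ 1 := by
        rw [ENNReal.ofReal_le_one, div_mul_eq_mul_div, one_mul, div_le_one (by positivity)]
        linarith

/-- Where Otelbaev's function is below `c`, the measure is small at scale `1 / √c`. -/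
lemma measure_Icc_lt_of_qstar_lt {μ : Measure ℝ} [IsFiniteMeasureOnCompacts μ] {c x : ℝ}
    (hc : 0 < c) (hx : qstar μ x < c) :
    μ (Icc (x - 1 / (2 * √c)) (x + 1 / (2 * √c))) < ENNReal.ofReal √c := by
  have hs : 0 < √c := Real.sqrt_pos.2 hc
  set A := {d : ℝ | 0 ≤ d ∧ ENNReal.ofReal d * μ (Icc (x - d / 2) (x + d / 2)) ≤ 1} with hA
  obtain ⟨d, ⟨hd0, hd⟩, hlt⟩ : ∃ d ∈ A, 1 / √c < d := by
    by_cases hb : BddAbove A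
    · obtain ⟨e, he, heA⟩ := exists_pos_mul_measure_Icc_le_one μ x
      have hpos : 0 < dFun μ x := he.trans_le (le_csSup hb ⟨he.le, heA⟩)
      have h2 : 1 / √c < dFun μ x := by
        rw [qstar, div_lt_comm₀ (by positivity) hc] at hx
        refine lt_of_pow_lt_pow_left₀ 2 hpos.le ?_
        rwa [div_pow, one_pow, Real.sq_sqrt hc.le]
      exact exists_lt_of_lt_csSup ⟨e, he.le, heA⟩ h2
    · rw [not_bddAbove_iff] at hb
      exact hb _
  have hdpos : 0 < d := lt_trans (by positivity) hlt
  calc _ ≤ μ (Icc (x - d / 2) (x + d / 2)) := by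
        refine measure_mono (Icc_subset_Icc ?_ ?_) <;>
        · have : 1 / (2 * √c) = 1 / √c / 2 := by field_simp
          linarith
    _ ≤ ENNReal.ofReal (1 / d) := by
        rw [ENNReal.ofReal_div_of_pos hdpos, ENNReal.ofReal_one,
          ENNReal.le_div_iff_mul_le (by simp [hdpos]) (by simp), mul_comm]
        exact hd
    _ < ENNReal.ofReal √c := by
        rw [ENNReal.ofReal_lt_ofReal_iff hs]
        rwa [div_lt_comm₀ hs hdpos] at hlt

lemma le_measure_Ioc {ν : Measure ℝ} [ν.OuterRegular] {l : ℝ} (hl : 0 < l) {m : ℝ≥0∞}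
    (h : ∀ a b : ℝ, l ≤ b - a → m ≤ ν (Icc a b)) (a : ℝ) : m ≤ ν (Ioc a (a + l)) := by
  by_contra! hcon
  obtain ⟨U, hsub, hU, hUm⟩ := Set.exists_isOpen_lt_of_lt _ _ hcon
  have hb : a + l ∈ U := hsub ⟨by linarith, le_rfl⟩
  obtain ⟨ε, hε, hball⟩ := Metric.isOpen_iff.1 hU _ hb
  refine absurd hUm (not_lt.2 ((h (a + ε / 2) (a + l + ε / 2) (by linarith)).trans
    (measure_mono fun y hy => ?_)))
  rcases le_or_gt y (a + l) with hy' | hy'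
  · exact hsub ⟨by linarith [hy.1], hy'⟩
  · refine hball ?_
    rw [Metric.mem_ball, Real.dist_eq, abs_of_pos (by linarith)]
    linarith [hy.2]

lemma nat_mul_le_measure_Ioc {ν : Measure ℝ} [ν.OuterRegular] {l : ℝ} (hl : 0 < l) {m : ℝ≥0∞}
    (h : ∀ a b : ℝ, l ≤ b - a → m ≤ ν (Icc a b)) (a : ℝ) (n : ℕ) :
    n * m ≤ ν (Ioc a (a + n * l)) := by
  induction n with
  | zero => simp
  | succ n ih =>
    have hun : Ioc a (a + (n + 1 : ℕ) * l) =
        Ioc a (a + n * l) ∪ Ioc (a + n * l) (a + n * l + l) := by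
      rw [Ioc_union_Ioc_eq_Ioc (by simp; positivity) (by linarith)]
      push_cast
      ring_nf
    rw [hun, measure_union (Ioc_disjoint_Ioc_of_le le_rfl) measurableSet_Ioc]
    push_cast
    rw [add_mul, one_mul]
    exact add_le_add ih (le_measure_Ioc hl h _)

/-- The arithmetic relating the length `r = 1 / (2 * √c)` to the constants of the problem. -/
lemma scale_inequality {l α lam r P : ℝ} (hl : 0 < l) (hα : 0 ≤ α) (hlam : 0 ≤ lam) (hr : 0 < r)
    (hP : 10 ≤ P)
    (hc : 1 / (4 * r ^ 2) = 3 * (α / l + 2 * lam) / (16 * P * (α * l + 2)))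
    {n : ℕ} (hn : r / (3 * l) < n + 1) :
    P / (2 * r) ≤ lam * (r / 2) + 3 / 4 * (n * α) := by
  have hA : 0 < α * l + 2 := by positivity
  have h1 : 4 * P * l * (α * l + 2) = 3 * r ^ 2 * (α + 2 * lam * l) := by
    have hP' : 0 < P := by linarith
    field_simp at hc
    linarith
  have h2 : 3 * r ^ 2 - 12 * n * r * l ≤ 4 * P * l ^ 2 := by
    rw [div_lt_iff₀ (by positivity)] at hn
    have hn0 : (0 : ℝ) ≤ n := n.cast_nonneg
    have h3 : r * r ≤ r * (3 * l * (n + 1)) := by gcongr; linarith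
    have h4 : 10 * l ^ 2 ≤ P * l ^ 2 := by gcongr
    rcases Nat.eq_zero_or_pos n with rfl | hpos
    · norm_num at hn ⊢
      nlinarith
    · have hn1 : (1 : ℝ) ≤ n := by exact_mod_cast hpos
      nlinarith [sq_nonneg ((n - 1 : ℝ) * l), mul_pos hr hl, mul_nonneg hn0 (mul_pos hr hl).le]
  have h3 : P ≤ lam * r ^ 2 + 3 / 2 * n * α * r := by
    have h4 : 0 ≤ α * (α * l + 2) := by positivity
    have h5 : 0 ≤ lam * l * r ^ 2 * (α * l + 2) := by positivity
    have h6 := mul_le_mul_of_nonneg_left h2 h4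
    have h7 : 4 * P * l * (α * l + 2) * (α * l) = 3 * r ^ 2 * (α + 2 * lam * l) * (α * l) := by
      rw [h1]
    refine le_of_mul_le_mul_left (a := 4 * l * (α * l + 2)) ?_ (by positivity)
    nlinarith
  rw [div_le_iff₀ (by positivity)]
  linarith

/-- The half-period of a cosine, supported on the interval of length `r` centred at `t`. -/
noncomputable def cosBump (r t : ℝ) : ℝ → ℂ :=
  (Ioo (t - r / 2) (t + r / 2)).indicator fun x => (Real.cos (Real.pi / r * (x - t)) : ℂ)

/-- The almost everywhere derivative of `cosBump r t`. -/
noncomputable def cosBumpDeriv (r t : ℝ) : ℝ → ℂ :=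
  (Ioo (t - r / 2) (t + r / 2)).indicator fun x =>
    ((-(Real.pi / r * Real.sin (Real.pi / r * (x - t))) : ℝ) : ℂ)

lemma continuous_cosBump {r : ℝ} (hr : 0 < r) (t : ℝ) : Continuous (cosBump r t) := by
  refine continuous_indicator ?_ (by fun_prop)
  intro x hx
  rw [frontier_Ioo (by linarith)] at hx
  rcases hx with rfl | rfl
  · have : Real.pi / r * (t - r / 2 - t) = -(Real.pi / 2) := by field_simp; ring
    simp only [this, Real.cos_neg, Real.cos_pi_div_two, Complex.ofReal_zero]
  · have : Real.pi / r * (t + r / 2 - t) = Real.pi / 2 := by field_simp; ring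
    simp only [this, Real.cos_pi_div_two, Complex.ofReal_zero]

lemma hasDerivAt_cosBump {r t x : ℝ} (h1 : x ≠ t - r / 2) (h2 : x ≠ t + r / 2) :
    HasDerivAt (cosBump r t) (cosBumpDeriv r t x) x := by
  by_cases hx : x ∈ Ioo (t - r / 2) (t + r / 2)
  · have hd : HasDerivAt (fun y => (Real.cos (Real.pi / r * (y - t)) : ℂ))
        (cosBumpDeriv r t x) x := by
      rw [cosBumpDeriv, indicator_of_mem hx]
      refine HasDerivAt.ofReal_comp ?_
      have hlin : HasDerivAt (fun y => Real.pi / r * (y - t)) (Real.pi / r) x := by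
        simpa using ((hasDerivAt_id' x).sub_const t).const_mul (Real.pi / r)
      convert hlin.cos using 1
      ring
    refine hd.congr_of_eventuallyEq ?_
    filter_upwards [isOpen_Ioo.mem_nhds hx] with y hy
    exact indicator_of_mem hy _
  · rw [cosBumpDeriv, indicator_of_notMem hx]
    have hx' : x ∈ (Icc (t - r / 2) (t + r / 2))ᶜ := by
      intro h
      exact hx ⟨lt_of_le_of_ne h.1 h1.symm, lt_of_le_of_ne h.2 h2⟩
    refine (hasDerivAt_const x (0 : ℂ)).congr_of_eventuallyEq ?_
    filter_upwards [isClosed_Icc.isOpen_compl.mem_nhds hx'] with y hy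
    exact indicator_of_notMem (fun h => hy (Ioo_subset_Icc_self h)) _

lemma integrable_cosBumpDeriv (r t : ℝ) : Integrable (cosBumpDeriv r t) := by
  rw [cosBumpDeriv, integrable_indicator_iff measurableSet_Ioo]
  refine (ContinuousOn.integrableOn_Icc ?_).mono_set Ioo_subset_Icc_self
  exact Continuous.continuousOn (by fun_prop)

lemma integral_cosBumpDeriv {r : ℝ} (hr : 0 < r) (t a b : ℝ) :
    cosBump r t b - cosBump r t a = ∫ x in a..b, cosBumpDeriv r t x := by
  refine (integral_eq_of_hasDerivAt_off_countable _ _ (s := {t - r / 2, t + r / 2})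
    (by simp) (continuous_cosBump hr t).continuousOn ?_
    (integrable_cosBumpDeriv r t).intervalIntegrable).symm
  intro x hx
  have := hx.2
  simp only [mem_insert_iff, mem_singleton_iff, not_or] at this
  exact hasDerivAt_cosBump this.1 this.2

lemma measurable_cosBump (r t : ℝ) : Measurable (cosBump r t) :=
  Measurable.indicator (by fun_prop) measurableSet_Ioo

lemma measurable_cosBumpDeriv (r t : ℝ) : Measurable (cosBumpDeriv r t) :=
  Measurable.indicator (by fun_prop) measurableSet_Ioo

lemma sqInt_indicator_ofReal (ν : Measure ℝ) {s : Set ℝ} (hs : MeasurableSet s) (u : ℝ → ℝ) :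
    sqInt ν (s.indicator fun x => (u x : ℂ)) = ∫⁻ x in s, ENNReal.ofReal (u x ^ 2) ∂ν := by
  rw [sqInt, ← lintegral_indicator hs]
  refine lintegral_congr fun x => ?_
  by_cases hx : x ∈ s
  · rw [indicator_of_mem hx, indicator_of_mem hx, ← enorm_eq_nnnorm, ← ofReal_norm,
      Complex.norm_real, ← ENNReal.ofReal_pow (norm_nonneg _), Real.norm_eq_abs, sq_abs]
  · simp [indicator_of_notMem hx]

lemma sqInt_volume_indicator_ofReal {a b : ℝ} (hab : a ≤ b) {u : ℝ → ℝ} (hu : Continuous u) :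
    sqInt volume ((Ioo a b).indicator fun x => (u x : ℂ)) =
      ENNReal.ofReal (∫ x in a..b, u x ^ 2) := by
  rw [sqInt_indicator_ofReal _ measurableSet_Ioo, intervalIntegral.integral_of_le hab,
    ← ofReal_integral_eq_lintegral_ofReal, integral_Ioc_eq_integral_Ioo]
  · exact ((hu.pow 2).continuousOn.integrableOn_Icc).mono_set Ioo_subset_Icc_self
  · exact ae_of_all _ fun x => sq_nonneg _

lemma sqInt_volume_cosBump {r : ℝ} (hr : 0 < r) (t : ℝ) :
    sqInt volume (cosBump r t) = ENNReal.ofReal (r / 2) := by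
  rw [cosBump, sqInt_volume_indicator_ofReal (by linarith) (by fun_prop)]
  congr 1
  have h1 : Real.pi / r * (t - r / 2 - t) = -(Real.pi / 2) := by field_simp; ring
  have h2 : Real.pi / r * (t + r / 2 - t) = Real.pi / 2 := by field_simp; ring
  have hne : Real.pi / r ≠ 0 := by positivity
  have h3 := intervalIntegral.integral_comp_sub_right (a := t - r / 2) (b := t + r / 2)
    (fun y => Real.cos (Real.pi / r * y) ^ 2) t
  rw [h3, intervalIntegral.integral_comp_mul_left (fun y => Real.cos y ^ 2) hne, h1, h2,
    integral_cos_sq]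
  simp
  field_simp

lemma sqInt_volume_cosBumpDeriv {r : ℝ} (hr : 0 < r) (t : ℝ) :
    sqInt volume (cosBumpDeriv r t) = ENNReal.ofReal (Real.pi ^ 2 / (2 * r)) := by
  rw [cosBumpDeriv, sqInt_volume_indicator_ofReal (by linarith) (by fun_prop)]
  congr 1
  have h1 : Real.pi / r * (t - r / 2 - t) = -(Real.pi / 2) := by field_simp; ring
  have h2 : Real.pi / r * (t + r / 2 - t) = Real.pi / 2 := by field_simp; ring
  have hne : Real.pi / r ≠ 0 := by positivity
  have h3 := intervalIntegral.integral_comp_sub_right (a := t - r / 2) (b := t + r / 2)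
    (fun y => Real.sin (Real.pi / r * y) ^ 2) t
  simp only [neg_sq, mul_pow, intervalIntegral.integral_const_mul]
  rw [h3, intervalIntegral.integral_comp_mul_left (fun y => Real.sin y ^ 2) hne, h1, h2,
    integral_sin_sq]
  simp
  field_simp

lemma sqInt_cosBump_le (ν : Measure ℝ) (r t : ℝ) :
    sqInt ν (cosBump r t) ≤ ν (Icc (t - r / 2) (t + r / 2)) := by
  rw [cosBump, sqInt_indicator_ofReal _ measurableSet_Ioo]
  calc _ ≤ ∫⁻ _ in Ioo (t - r / 2) (t + r / 2), 1 ∂ν := by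
        refine lintegral_mono fun x => ?_
        rw [ENNReal.ofReal_le_one]
        exact Real.cos_sq_le_one _
    _ ≤ _ := by
        rw [setLIntegral_one]
        exact measure_mono Ioo_subset_Icc_self

lemma le_sqInt_cosBump (ν : Measure ℝ) {r : ℝ} (hr : 0 < r) (t : ℝ) :
    ENNReal.ofReal (3 / 4) * ν (Ioc (t - r / 6) (t + r / 6)) ≤ sqInt ν (cosBump r t) := by
  rw [cosBump, sqInt_indicator_ofReal _ measurableSet_Ioo]
  calc _ = ∫⁻ _ in Ioc (t - r / 6) (t + r / 6), ENNReal.ofReal (3 / 4) ∂ν := by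
        rw [setLIntegral_const]
    _ ≤ ∫⁻ x in Ioc (t - r / 6) (t + r / 6),
          ENNReal.ofReal (Real.cos (Real.pi / r * (x - t)) ^ 2) ∂ν := by
        refine setLIntegral_mono' measurableSet_Ioc fun x hx => ENNReal.ofReal_le_ofReal ?_
        have h1 : |x - t| ≤ r / 6 := abs_le.2 ⟨by linarith [hx.1], by linarith [hx.2]⟩
        have h2 : |Real.pi / r * (x - t)| ≤ Real.pi / 6 := by
          rw [abs_mul, abs_of_pos (by positivity)]
          calc _ ≤ Real.pi / r * (r / 6) := by gcongr
            _ = Real.pi / 6 := by field_simp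
        have h3 : √3 / 2 ≤ Real.cos (Real.pi / r * (x - t)) := by
          rw [← Real.cos_pi_div_six, ← Real.cos_abs (Real.pi / r * (x - t))]
          exact Real.cos_le_cos_of_nonneg_of_le_pi (abs_nonneg _)
            (by linarith [Real.pi_pos]) h2
        calc (3 / 4 : ℝ) = (√3 / 2) ^ 2 := by rw [div_pow, Real.sq_sqrt] <;> norm_num
          _ ≤ _ := by gcongr
    _ ≤ _ := lintegral_mono_set fun x (hx : x ∈ Ioc _ _) =>
        (⟨by linarith [hx.1], by linarith [hx.2]⟩ : x ∈ Ioo _ _)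

/-- `sqInt` is additive on families of functions with disjoint supports. -/
lemma sqInt_sum {ι : Type*} (ν : Measure ℝ) (s : Finset ι) (a : ι → ℂ) {u : ι → ℝ → ℂ}
    (hu : ∀ i, Measurable (u i)) (hdisj : ∀ i ∈ s, ∀ j ∈ s, i ≠ j → ∀ x, u i x = 0 ∨ u j x = 0) :
    sqInt ν (∑ i ∈ s, a i • u i) = ∑ i ∈ s, ENNReal.ofReal (‖a i‖ ^ 2) * sqInt ν (u i) := by
  have hpt : ∀ x, (‖(∑ i ∈ s, a i • u i) x‖₊ : ℝ≥0∞) ^ 2 =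
      ∑ i ∈ s, ENNReal.ofReal (‖a i‖ ^ 2) * (‖u i x‖₊ : ℝ≥0∞) ^ 2 := by
    intro x
    have hterm : ∀ i, (‖a i * u i x‖₊ : ℝ≥0∞) ^ 2 =
        ENNReal.ofReal (‖a i‖ ^ 2) * (‖u i x‖₊ : ℝ≥0∞) ^ 2 := by
      intro i
      rw [nnnorm_mul, ENNReal.coe_mul, mul_pow, ENNReal.ofReal_pow (norm_nonneg _),
        ofReal_norm, enorm_eq_nnnorm]
    simp only [Finset.sum_apply, Pi.smul_apply, smul_eq_mul]
    by_cases h : ∃ i ∈ s, u i x ≠ 0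
    · obtain ⟨i, hi, hne⟩ := h
      have hz : ∀ j ∈ s, j ≠ i → u j x = 0 := fun j hj hji =>
        (hdisj j hj i hi hji x).resolve_right hne
      rw [Finset.sum_eq_single_of_mem i hi fun j hj hji => by rw [hz j hj hji, mul_zero],
        Finset.sum_eq_single_of_mem i hi fun j hj hji => by simp [hz j hj hji], hterm]
    · push Not at h
      rw [Finset.sum_eq_zero fun i hi => by rw [h i hi, mul_zero],
        Finset.sum_eq_zero fun i hi => by simp [h i hi]]
      simp
  simp only [sqInt, hpt]
  rw [lintegral_finsetSum _ fun i _ => by have := hu i; fun_prop]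
  refine Finset.sum_congr rfl fun i _ => ?_
  rw [lintegral_const_mul _ (by have := hu i; fun_prop)]

lemma MemDom.ae_eq {ν : Measure ℝ} {f g g' : ℝ → ℂ} (h : MemDom ν f g) (h' : MemDom ν f g') :
    g =ᵐ[volume] g' := by
  filter_upwards [LocallyIntegrable.ae_hasDerivAt_integral h.locInt,
    LocallyIntegrable.ae_hasDerivAt_integral h'.locInt] with x hx hx'
  have heq : (fun y => ∫ t in (0 : ℝ)..y, g t) = fun y => ∫ t in (0 : ℝ)..y, g' t := by
    funext y
    rw [← h.fund, ← h'.fund]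
  have := hx 0
  rw [heq] at this
  exact this.unique (hx' 0)

lemma sqInt_congr_ae {ν : Measure ℝ} {f g : ℝ → ℂ} (h : f =ᵐ[ν] g) : sqInt ν f = sqInt ν g :=
  lintegral_congr_ae (h.mono fun x hx => by simp only [hx])

lemma cosBump_disjoint {r s t x : ℝ} (hst : r ≤ |s - t|)
    (hs : x ∈ Ioo (s - r / 2) (s + r / 2)) : x ∉ Ioo (t - r / 2) (t + r / 2) := by
  intro ht
  have h1 := hs.1
  have h2 := hs.2
  have h3 := ht.1
  have h4 := ht.2
  rcases le_abs.1 hst with h | h <;> linarith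

lemma cosBump_eq_zero_or {r s t : ℝ} (hst : r ≤ |s - t|) (x : ℝ) :
    cosBump r s x = 0 ∨ cosBump r t x = 0 := by
  by_cases hs : x ∈ Ioo (s - r / 2) (s + r / 2)
  · exact Or.inr (indicator_of_notMem (cosBump_disjoint hst hs) _)
  · exact Or.inl (indicator_of_notMem hs _)

lemma cosBumpDeriv_eq_zero_or {r s t : ℝ} (hst : r ≤ |s - t|) (x : ℝ) :
    cosBumpDeriv r s x = 0 ∨ cosBumpDeriv r t x = 0 := by
  by_cases hs : x ∈ Ioo (s - r / 2) (s + r / 2)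
  · exact Or.inr (indicator_of_notMem (cosBump_disjoint hst hs) _)
  · exact Or.inl (indicator_of_notMem hs _)

lemma cosBump_self {r : ℝ} (hr : 0 < r) (t : ℝ) : cosBump r t t = 1 := by
  rw [cosBump, indicator_of_mem (by constructor <;> linarith)]
  simp

lemma sqInt_cosBump_lt_top (ν : Measure ℝ) [IsFiniteMeasureOnCompacts ν] (r t : ℝ) :
    sqInt ν (cosBump r t) < ⊤ :=
  (sqInt_cosBump_le ν r t).trans_lt isCompact_Icc.measure_lt_top

section Span

variable {r : ℝ} {T : Finset ℝ}

lemma sqInt_sum_cosBump (ν : Measure ℝ) (hsep : ∀ x ∈ T, ∀ y ∈ T, x ≠ y → r ≤ |x - y|)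
    (a : T → ℂ) :
    sqInt ν (∑ t, a t • cosBump r t) =
      ∑ t : T, ENNReal.ofReal (‖a t‖ ^ 2) * sqInt ν (cosBump r t) :=
  sqInt_sum ν _ a (fun t : T => measurable_cosBump r t) fun s _ t _ hst =>
    cosBump_eq_zero_or (hsep s s.2 t t.2 (Subtype.coe_injective.ne hst))

lemma sqInt_sum_cosBumpDeriv (ν : Measure ℝ) (hsep : ∀ x ∈ T, ∀ y ∈ T, x ≠ y → r ≤ |x - y|)
    (a : T → ℂ) :
    sqInt ν (∑ t, a t • cosBumpDeriv r t) =
      ∑ t : T, ENNReal.ofReal (‖a t‖ ^ 2) * sqInt ν (cosBumpDeriv r t) :=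
  sqInt_sum ν _ a (fun t : T => measurable_cosBumpDeriv r t) fun s _ t _ hst =>
    cosBumpDeriv_eq_zero_or (hsep s s.2 t t.2 (Subtype.coe_injective.ne hst))

lemma toReal_sum_ofReal_mul {ι : Type*} (s : Finset ι) (w : ι → ℝ) (hw : ∀ i, 0 ≤ w i)
    {m : ι → ℝ≥0∞} (hm : ∀ i, m i < ⊤) :
    (∑ i ∈ s, ENNReal.ofReal (w i) * m i).toReal = ∑ i ∈ s, w i * (m i).toReal := by
  rw [ENNReal.toReal_sum fun i _ => ENNReal.mul_ne_top ENNReal.ofReal_ne_top (hm i).ne]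
  exact Finset.sum_congr rfl fun i _ => by rw [ENNReal.toReal_mul, ENNReal.toReal_ofReal (hw i)]

lemma memDom_sum_cosBump (ν : Measure ℝ) [IsFiniteMeasureOnCompacts ν] (hr : 0 < r)
    (hsep : ∀ x ∈ T, ∀ y ∈ T, x ≠ y → r ≤ |x - y|) (a : T → ℂ) :
    MemDom ν (∑ t, a t • cosBump r t) (∑ t, a t • cosBumpDeriv r t) where
  locInt := (integrable_finsetSum' _ fun (t : T) _ =>
    (integrable_cosBumpDeriv r t).smul (a t)).locallyIntegrable
  fund x y := by
    simp only [Finset.sum_apply, Pi.smul_apply]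
    rw [intervalIntegral.integral_finsetSum (f := fun (t : T) z => a t • cosBumpDeriv r t z)
      fun (t : T) _ => ((integrable_cosBumpDeriv r t).smul (a t)).intervalIntegrable,
      ← Finset.sum_sub_distrib]
    refine Finset.sum_congr rfl fun t _ => ?_
    rw [intervalIntegral.integral_smul, ← integral_cosBumpDeriv hr, smul_sub]
  f_L2 := by
    rw [sqInt_sum_cosBump _ hsep]
    exact ENNReal.sum_lt_top.2 fun t _ =>
      ENNReal.mul_lt_top ENNReal.ofReal_lt_top (sqInt_cosBump_lt_top _ _ _)
  g_L2 := by
    rw [sqInt_sum_cosBumpDeriv _ hsep]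
    refine ENNReal.sum_lt_top.2 fun t _ => ENNReal.mul_lt_top ENNReal.ofReal_lt_top ?_
    rw [sqInt_volume_cosBumpDeriv hr]
    exact ENNReal.ofReal_lt_top
  f_mu := by
    rw [sqInt_sum_cosBump _ hsep]
    exact ENNReal.sum_lt_top.2 fun t _ =>
      ENNReal.mul_lt_top ENNReal.ofReal_lt_top (sqInt_cosBump_lt_top _ _ _)

lemma goodSubspace_span_cosBump (μp μm : Measure ℝ) [IsFiniteMeasureOnCompacts μp]
    [IsFiniteMeasureOnCompacts μm] {lam : ℝ} (hr : 0 < r)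
    (hsep : ∀ x ∈ T, ∀ y ∈ T, x ≠ y → r ≤ |x - y|)
    (hT : ∀ t ∈ T, Real.pi ^ 2 / (2 * r) + (sqInt μp (cosBump r t)).toReal
      - (sqInt μm (cosBump r t)).toReal < lam * (r / 2)) :
    GoodSubspace μp μm lam (Submodule.span ℂ (range fun t : T => cosBump r t)) := by
  constructor
  · intro f hf
    obtain ⟨a, rfl⟩ := (Submodule.mem_span_range_iff_exists_fun ℂ).1 hf
    exact ⟨_, memDom_sum_cosBump μp hr hsep a⟩
  · intro f hf hf0 g hg
    obtain ⟨a, rfl⟩ := (Submodule.mem_span_range_iff_exists_fun ℂ).1 hf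
    rw [formQ, sqInt_congr_ae (hg.ae_eq (memDom_sum_cosBump μp hr hsep a)),
      sqInt_sum_cosBump _ hsep, sqInt_sum_cosBump _ hsep, sqInt_sum_cosBump _ hsep,
      sqInt_sum_cosBumpDeriv _ hsep]
    have hw : ∀ t : T, 0 ≤ ‖a t‖ ^ 2 := fun t => by positivity
    rw [toReal_sum_ofReal_mul _ _ hw fun t => sqInt_cosBump_lt_top μp r t,
      toReal_sum_ofReal_mul _ _ hw fun t => sqInt_cosBump_lt_top μm r t,
      toReal_sum_ofReal_mul _ _ hw fun t => sqInt_cosBump_lt_top volume r t,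
      toReal_sum_ofReal_mul _ _ hw fun t => by
        rw [sqInt_volume_cosBumpDeriv hr]
        exact ENNReal.ofReal_lt_top,
      Finset.mul_sum, ← Finset.sum_add_distrib, ← Finset.sum_sub_distrib]
    obtain ⟨s, hs⟩ : ∃ s, a s ≠ 0 := by
      by_contra! h
      exact hf0 (by simp [h])
    have hterm : ∀ t : T, ‖a t‖ ^ 2 * (sqInt volume (cosBumpDeriv r t)).toReal
        + ‖a t‖ ^ 2 * (sqInt μp (cosBump r t)).toReal
        - ‖a t‖ ^ 2 * (sqInt μm (cosBump r t)).toReal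
        = ‖a t‖ ^ 2 * (Real.pi ^ 2 / (2 * r) + (sqInt μp (cosBump r t)).toReal
          - (sqInt μm (cosBump r t)).toReal) := by
      intro t
      rw [sqInt_volume_cosBumpDeriv hr, ENNReal.toReal_ofReal (by positivity)]
      ring
    have hrhs : ∀ t : T, lam * (‖a t‖ ^ 2 * (sqInt volume (cosBump r t)).toReal)
        = ‖a t‖ ^ 2 * (lam * (r / 2)) := by
      intro t
      rw [sqInt_volume_cosBump hr, ENNReal.toReal_ofReal (by positivity)]
      ring
    simp only [hterm, hrhs]
    refine Finset.sum_lt_sum (fun t _ => mul_le_mul_of_nonneg_left (hT t t.2).le (hw t))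
      ⟨s, Finset.mem_univ _, mul_lt_mul_of_pos_left (hT s s.2) ?_⟩
    have := norm_pos_iff.2 hs
    positivity

lemma linearIndependent_cosBump (hr : 0 < r)
    (hsep : ∀ x ∈ T, ∀ y ∈ T, x ≠ y → r ≤ |x - y|) :
    LinearIndependent ℂ fun t : T => cosBump r t := by
  rw [Fintype.linearIndependent_iff]
  intro a ha t
  have h := congrFun ha t
  simp only [Finset.sum_apply, Pi.smul_apply, smul_eq_mul, Pi.zero_apply] at h
  rwa [Finset.sum_eq_single_of_mem t (Finset.mem_univ _), cosBump_self hr, mul_one] at h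
  intro s _ hst
  have := (cosBump_eq_zero_or (hsep s s.2 t t.2 (Subtype.coe_injective.ne hst)) t).resolve_right
    (by simp [cosBump_self hr])
  rw [this, mul_zero]

lemma card_le_NVar (μp μm : Measure ℝ) [IsFiniteMeasureOnCompacts μp]
    [IsFiniteMeasureOnCompacts μm] {lam : ℝ} (hr : 0 < r)
    (hsep : ∀ x ∈ T, ∀ y ∈ T, x ≠ y → r ≤ |x - y|)
    (hT : ∀ t ∈ T, Real.pi ^ 2 / (2 * r) + (sqInt μp (cosBump r t)).toReal
      - (sqInt μm (cosBump r t)).toReal < lam * (r / 2)) :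
    (T.card : ℝ≥0∞) ≤ NVar μp μm lam := by
  refine le_trans (le_of_eq ?_) (le_iSup _ ⟨_, goodSubspace_span_cosBump μp μm hr hsep hT⟩)
  have hli := linearIndependent_cosBump hr hsep
  dsimp only
  rw [rank_span hli, Cardinal.mk_range_eq _ hli.injective]
  simp

end Span

lemma ofReal_one_div_mul_le_of_forall_nat {N V : ℝ≥0∞} {r : ℝ} (hr : 0 < r)
    (h : ∀ n : ℕ, n * ENNReal.ofReal r < V → (n + 1 : ℕ) ≤ N) :
    ENNReal.ofReal (1 / r) * V ≤ N := by
  by_contra! hcon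
  have hN : N ≠ ⊤ := hcon.ne_top
  set n := ⌊N.toReal⌋₊
  have hn : (n : ℝ≥0∞) ≤ N := by
    rw [← ENNReal.ofReal_toReal hN, ← ENNReal.ofReal_natCast]
    exact ENNReal.ofReal_le_ofReal (Nat.floor_le ENNReal.toReal_nonneg)
  have hn' : N < (n + 1 : ℕ) := by
    rw [← ENNReal.ofReal_toReal hN, ← ENNReal.ofReal_natCast,
      ENNReal.ofReal_lt_ofReal_iff (by positivity)]
    exact_mod_cast Nat.lt_floor_add_one N.toReal
  refine absurd (h n ?_) (not_le.2 hn')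
  have hlt := hn.trans_lt hcon
  have hr0 : ENNReal.ofReal r ≠ 0 := by simpa using hr
  calc (n : ℝ≥0∞) * ENNReal.ofReal r < ENNReal.ofReal (1 / r) * V * ENNReal.ofReal r :=
        ENNReal.mul_lt_mul_left hr0 ENNReal.ofReal_ne_top hlt
    _ = V := by
        rw [mul_right_comm, ← ENNReal.ofReal_mul (by positivity), one_div_mul_cancel hr.ne']
        simp

/-- Lower bound for the spectral distribution function: for `μ = μ₊ − μ₋ ∈ 𝔐_β`, with
constants `l > 0`, `α ≥ 0` such that `μ₋(I) ≥ α` for every interval `I` of length at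
least `l`, `λ ≥ 0` and `c = 3(α/l + 2λ)/(16(π² + 1)(αl + 2))`, one has
`N(λ, H_μ) ≥ 2√c·Leb({x : q*_{μ₊}(x) < c})`. -/
theorem spectral_lower_bound (β : ℝ) (hβ : 0 ≤ β)
    (μp μm : Measure ℝ) [μp.Regular] [μm.Regular]
    (hμp : μp univ ≠ 0)
    (hμm : ∀ x : ℝ, μm (Icc x (x + 1)) ≤ ENNReal.ofReal β)
    (l α : ℝ) (hl : 0 < l) (hα : 0 ≤ α)
    (hμmα : ∀ a b : ℝ, l ≤ b - a → ENNReal.ofReal α ≤ μm (Icc a b))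
    (lam : ℝ) (hlam : 0 ≤ lam)
    (c : ℝ) (hc : c = 3 * (α / l + 2 * lam) / (16 * (Real.pi ^ 2 + 1) * (α * l + 2))) :
    ENNReal.ofReal (2 * Real.sqrt c) * volume {x : ℝ | qstar μp x < c} ≤
      NVar μp μm lam := by
  have hc0 : 0 ≤ c := by rw [hc]; positivity
  rcases hc0.eq_or_lt with hc0 | hcpos
  · simp [← hc0]
  have hs : 0 < √c := Real.sqrt_pos.2 hcpos
  set r := 1 / (2 * √c) with hr_def
  have hr : 0 < r := by positivity
  have hrs : 2 * √c = 1 / r := by rw [hr_def, one_div_one_div]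
  have hcr : 1 / (4 * r ^ 2) = c := by
    rw [hr_def, div_pow, mul_pow, Real.sq_sqrt hc0]
    field_simp
    norm_num
  rw [hrs]
  refine ofReal_one_div_mul_le_of_forall_nat hr fun n hn => ?_
  obtain ⟨T, hTS, hTc, hsep⟩ := exists_separated hr.le n _ hn
  rw [← hTc]
  refine card_le_NVar μp μm hr hsep fun t ht => ?_
  have hplus : (sqInt μp (cosBump r t)).toReal < 1 / (2 * r) := by
    have h1 : sqInt μp (cosBump r t) < ENNReal.ofReal √c := by
      refine (sqInt_cosBump_le μp r t).trans_lt (lt_of_le_of_lt (measure_mono ?_)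
        (measure_Icc_lt_of_qstar_lt hcpos (hTS ht)))
      exact Icc_subset_Icc (by linarith) (by linarith)
    have h2 : √c = 1 / (2 * r) := by rw [hr_def]; field_simp
    rw [← h2]
    exact (ENNReal.lt_ofReal_iff_toReal_lt h1.ne_top).1 h1
  set k := ⌊r / (3 * l)⌋₊ with hk_def
  have hkl : k * l ≤ r / 3 := by
    have := Nat.floor_le (show 0 ≤ r / (3 * l) by positivity)
    rw [← hk_def, le_div_iff₀ (by positivity)] at this
    linarith
  have hminus : 3 / 4 * (k * α) ≤ (sqInt μm (cosBump r t)).toReal := by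
    have h1 : ENNReal.ofReal (3 / 4 * (k * α)) ≤ sqInt μm (cosBump r t) := by
      refine le_trans ?_ (le_sqInt_cosBump μm hr t)
      rw [ENNReal.ofReal_mul (by norm_num), ENNReal.ofReal_mul (by positivity),
        ENNReal.ofReal_natCast]
      gcongr
      refine (nat_mul_le_measure_Ioc hl hμmα (t - r / 6) k).trans (measure_mono ?_)
      exact Ioc_subset_Ioc_right (by linarith)
    exact (ENNReal.ofReal_le_iff_le_toReal (sqInt_cosBump_lt_top μm r t).ne).1 h1
  have hP : (10 : ℝ) ≤ Real.pi ^ 2 + 1 := by nlinarith [Real.pi_gt_three]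
  have hscale := scale_inequality hl hα hlam hr hP (hcr.trans hc) (Nat.lt_floor_add_one _)
  rw [add_div] at hscale
  linarith
end
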